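/- Let X₁,…,X_m be infinite dimensional Banach spaces with normalized unconditional Schauder bases (x_n^{(k)}), k = 1,…,m, let n₁,…,n_m ≥ 1, let q > 0, and let Y be an infinite dimensional Banach space such that there exists s with max(q, 2) ≤ s, s > q, for which Y does NOT have cotype s (i.e., q is less than the cotype index cot Y = inf{s : Y has cotype s}). If every continuous (n₁,…,n_m)-homogeneous polynomial from X₁ × ⋯ × X_m into Y is absolutely (q;1)-summing, then for every t > q and all x_k = ∑_j a_j^{(k)} x_j^{(k)} ∈ X_k (k = 1,…,m) one has ∑_j (∏_{k=1}^m |a_j^{(k)}|^{n_k})^t < ∞. -/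

import Mathlib

open scoped BigOperators

/-- A sequence in a normed space is *weakly 1-summable*. -/
def WeaklySummable (𝕂 : Type*) [RCLike 𝕂] {X : Type*} [NormedAddCommGroup X]
    [NormedSpace 𝕂 X] (x : ℕ → X) : Prop :=
  ∀ φ : X →L[𝕂] 𝕂, Summable fun j => ‖φ (x j)‖

/-- `P` is a continuous `(n 0, …, n (m-1))`-homogeneous polynomial, i.e. it comes from a
continuous multilinear map in `n 0 + ⋯ + n (m-1)` variables (`n k` copies of `X k`). -/
def IsMultiPoly (𝕂 : Type*) [RCLike 𝕂] {m : ℕ} (n : Fin m → ℕ)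
    {X : Fin m → Type*} [∀ k, NormedAddCommGroup (X k)] [∀ k, NormedSpace 𝕂 (X k)]
    {Y : Type*} [NormedAddCommGroup Y] [NormedSpace 𝕂 Y]
    (P : (∀ k, X k) → Y) : Prop :=
  ∃ T : ContinuousMultilinearMap 𝕂 (fun i : Σ k : Fin m, Fin (n k) => X i.1) Y,
    ∀ x : ∀ k, X k, P x = T fun i => x i.1

/-- A normed space has cotype `q` (Rademacher averages written as an average over signs). -/
def HasCotype (X : Type*) [NormedAddCommGroup X] (q : ℝ) : Prop :=
  ∃ C : ℝ, 0 ≤ C ∧ ∀ (k : ℕ) (x : Fin k → X),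
    (∑ j, ‖x j‖ ^ q) ^ (1 / q) ≤
      C * Real.sqrt ((2 ^ k : ℝ)⁻¹ *
        ∑ ε : Fin k → Bool, ‖∑ j, (if ε j then x j else -x j)‖ ^ 2)

/-- `e` is a normalized unconditional Schauder basis of `X`. -/
def IsNormalizedUncondBasis (𝕂 : Type*) [RCLike 𝕂] (X : Type*) [NormedAddCommGroup X]
    [NormedSpace 𝕂 X] (e : ℕ → X) : Prop :=
  (∀ n, ‖e n‖ = 1) ∧
  (∀ x : X, ∃! a : ℕ → 𝕂, HasSum (fun n => a n • e n) x) ∧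
  ∃ ρ : ℝ, 1 ≤ ρ ∧ ∀ (a ε : ℕ → 𝕂) (x y : X),
    (∀ n, ε n = 1 ∨ ε n = -1) →
    HasSum (fun n => a n • e n) x → HasSum (fun n => (ε n * a n) • e n) y →
    ‖y‖ ≤ ρ * ‖x‖

/-- `(x + y) ^ q ≤ 2 ^ q * (x ^ q + y ^ q)` for every `q > 0`. -/
lemma add_rpow_le_two_rpow_mul {x y q : ℝ} (hx : 0 ≤ x) (hy : 0 ≤ y) (hq : 0 < q) :
    (x + y) ^ q ≤ 2 ^ q * (x ^ q + y ^ q) := by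
  have hm : 0 ≤ max x y := le_max_of_le_left hx
  calc (x + y) ^ q ≤ (2 * max x y) ^ q := by
        refine Real.rpow_le_rpow (by positivity) ?_ hq.le
        linarith [le_max_left x y, le_max_right x y]
    _ = 2 ^ q * (max x y) ^ q := Real.mul_rpow (by norm_num) hm
    _ ≤ 2 ^ q * (x ^ q + y ^ q) := by
        refine mul_le_mul_of_nonneg_left ?_ (by positivity)
        have h1 : 0 ≤ x ^ q := Real.rpow_nonneg hx q
        have h2 : 0 ≤ y ^ q := Real.rpow_nonneg hy q
        rcases le_total x y with h | h
        · rw [max_eq_right h]; linarith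
        · rw [max_eq_left h]; linarith

/-- Uniform boundedness in the (quasi-normed) space `ℓ_q`. -/
lemma exists_sum_rpow_le_of_summable {𝕂 : Type*} [RCLike 𝕂] {E Y : Type*}
    [NormedAddCommGroup E] [NormedSpace 𝕂 E] [CompleteSpace E]
    [NormedAddCommGroup Y] [NormedSpace 𝕂 Y] {q : ℝ} (hq : 0 < q)
    (L : ℕ → E →L[𝕂] Y) (h : ∀ T, Summable fun j => ‖L j T‖ ^ q) :
    ∃ K : ℝ, ∀ T, ∀ s : Finset ℕ, ∑ j ∈ s, ‖L j T‖ ^ q ≤ K * ‖T‖ ^ q := by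
  let F : ℕ → Set E := fun n => {T | ∀ s : Finset ℕ, ∑ j ∈ s, ‖L j T‖ ^ q ≤ n}
  have hF : ∀ n, IsClosed (F n) := by
    intro n
    simp only [F, Set.ofPred_forall]
    refine isClosed_iInter fun s => isClosed_le ?_ continuous_const
    refine continuous_finsetSum _ fun j _ => ?_
    exact ((L j).continuous.norm).rpow_const fun _ => Or.inr hq.le
  have hU : ⋃ n, F n = Set.univ := by
    refine Set.eq_univ_of_forall fun T => Set.mem_iUnion.2 ?_
    obtain ⟨n, hn⟩ := exists_nat_ge (∑' j, ‖L j T‖ ^ q)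
    exact ⟨n, fun s => ((h T).sum_le_tsum s fun _ _ => by positivity).trans hn⟩
  obtain ⟨n, T₀, hT₀⟩ := nonempty_interior_of_iUnion_of_closed hF hU
  obtain ⟨r, hr, hball⟩ := Metric.mem_nhds_iff.1 (mem_interior_iff_mem_nhds.1 hT₀)
  refine ⟨2 ^ q * (2 * n) * (2 / r) ^ q, fun T s => ?_⟩
  by_cases hT : T = 0
  · subst hT
    simp [Real.zero_rpow hq.ne']
  have hTn : 0 < ‖T‖ := norm_pos_iff.2 hT
  set c : ℝ := r / (2 * ‖T‖) with hc
  have hc0 : 0 < c := by positivity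
  have h1 : T₀ + (c : 𝕂) • T ∈ F n := by
    apply hball
    rw [Metric.mem_ball, dist_eq_norm, add_sub_cancel_left, norm_smul, RCLike.norm_ofReal,
      abs_of_pos hc0, hc]
    field_simp
    norm_num
  have h0 : T₀ ∈ F n := hball (Metric.mem_ball_self hr)
  have key : c ^ q * ∑ j ∈ s, ‖L j T‖ ^ q ≤ 2 ^ q * (2 * n) := by
    rw [Finset.mul_sum]
    calc ∑ j ∈ s, c ^ q * ‖L j T‖ ^ q
        ≤ ∑ j ∈ s, 2 ^ q * (‖L j (T₀ + (c : 𝕂) • T)‖ ^ q + ‖L j T₀‖ ^ q) := by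
          refine Finset.sum_le_sum fun j _ => ?_
          rw [← Real.mul_rpow hc0.le (norm_nonneg _)]
          refine le_trans ?_ (add_rpow_le_two_rpow_mul (norm_nonneg _) (norm_nonneg _) hq)
          refine Real.rpow_le_rpow (by positivity) ?_ hq.le
          have : c * ‖L j T‖ = ‖L j (T₀ + (c : 𝕂) • T) - L j T₀‖ := by
            rw [map_add, add_sub_cancel_left, map_smul, norm_smul, RCLike.norm_ofReal,
              abs_of_pos hc0]
          rw [this]
          exact norm_sub_le _ _
      _ ≤ 2 ^ q * (2 * n) := by
          rw [← Finset.mul_sum, Finset.sum_add_distrib]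
          refine mul_le_mul_of_nonneg_left ?_ (by positivity)
          linarith [h1 s, h0 s]
  have hcc : (2 / r) ^ q * ‖T‖ ^ q * c ^ q = 1 := by
    rw [← Real.mul_rpow (by positivity) (by positivity),
      ← Real.mul_rpow (by positivity) (by positivity), hc]
    have : 2 / r * ‖T‖ * (r / (2 * ‖T‖)) = 1 := by field_simp
    rw [this, Real.one_rpow]
  calc ∑ j ∈ s, ‖L j T‖ ^ q
      = (2 / r) ^ q * ‖T‖ ^ q * (c ^ q * ∑ j ∈ s, ‖L j T‖ ^ q) := by
        rw [← mul_assoc, hcc, one_mul]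
    _ ≤ (2 / r) ^ q * ‖T‖ ^ q * (2 ^ q * (2 * n)) :=
        mul_le_mul_of_nonneg_left key (by positivity)
    _ = _ := by ring

/-- If every homogeneous polynomial is absolutely `(q;1)`-summing, then this holds with a
uniform constant. -/
lemma exists_uniform_summing_constant {𝕂 : Type*} [RCLike 𝕂]
    {Y : Type*} [NormedAddCommGroup Y] [NormedSpace 𝕂 Y] [CompleteSpace Y]
    {q : ℝ} (hq : 0 < q) {m : ℕ} (n : Fin m → ℕ)
    (X : Fin m → Type*) [∀ k, NormedAddCommGroup (X k)] [∀ k, NormedSpace 𝕂 (X k)]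
    (hsum : ∀ P : (∀ k, X k) → Y, IsMultiPoly 𝕂 n P →
      ∀ x : ∀ k, ℕ → X k, (∀ k, WeaklySummable 𝕂 (x k)) →
        Summable fun j => ‖P fun k => x k j‖ ^ q) :
    ∃ K : ℝ, 0 ≤ K ∧
      ∀ (T : ContinuousMultilinearMap 𝕂 (fun i : Σ k : Fin m, Fin (n k) => X i.1) Y)
        (u : ∀ k, ℕ → X k),
        (∀ k (φ : X k →L[𝕂] 𝕂) (s : Finset ℕ), ∑ j ∈ s, ‖φ (u k j)‖ ≤ ‖φ‖) →
        ∀ s : Finset ℕ, ∑ j ∈ s, ‖T fun i => u i.1 j‖ ^ q ≤ K * ‖T‖ ^ q := by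
  by_contra hcon
  push Not at hcon
  set D : ℕ := Fintype.card (Σ k : Fin m, Fin (n k)) with hD
  let b : ℕ → ℝ := fun i => ((((1 / 2 : ℝ) ^ i) ^ D) ^ q)
  have hb : ∀ i, 0 < b i := fun i => by positivity
  choose T u hu s hs using fun i : ℕ => hcon (i / b i) (by have := hb i; positivity)
  let U : ∀ k, ℕ → X k := fun k j =>
    (((1 / 2 : ℝ) ^ (Nat.unpair j).1 : ℝ) : 𝕂) • u (Nat.unpair j).1 k (Nat.unpair j).2
  have hUw : ∀ k, WeaklySummable 𝕂 (U k) := by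
    intro k φ
    have h2 : Summable fun p : ℕ × ℕ => (1 / 2 : ℝ) ^ p.1 * ‖φ (u p.1 k p.2)‖ := by
      rw [summable_prod_of_nonneg (fun p => by positivity)]
      have hin : ∀ i, Summable fun j => (1 / 2 : ℝ) ^ i * ‖φ (u i k j)‖ := fun i =>
        (summable_of_sum_le (fun _ => norm_nonneg _) (hu i k φ)).mul_left _
      refine ⟨hin, ?_⟩
      refine Summable.of_nonneg_of_le (fun i => tsum_nonneg fun j => by positivity)
        (fun i => ?_) (summable_geometric_two.mul_right ‖φ‖)
      change ∑' j, (1 / 2 : ℝ) ^ i * ‖φ (u i k j)‖ ≤ _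
      rw [tsum_mul_left]
      refine mul_le_mul_of_nonneg_left ?_ (by positivity)
      exact Real.tsum_le_of_sum_le (fun _ => norm_nonneg _) (hu i k φ)
    have h3 := (Nat.pairEquiv.symm.summable_iff).2 h2
    refine h3.congr fun j => ?_
    simp only [U, Function.comp, Nat.pairEquiv_symm_apply, map_smul, norm_smul, RCLike.norm_ofReal]
    rw [abs_of_nonneg (by positivity)]
  obtain ⟨K, hK⟩ := exists_sum_rpow_le_of_summable hq
    (fun j => ContinuousMultilinearMap.apply 𝕂
      (fun i : Σ k : Fin m, Fin (n k) => X i.1) Y fun i => U i.1 j)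
    (fun T => hsum (fun x => T fun i => x i.1) ⟨T, fun _ => rfl⟩ U hUw)
  obtain ⟨i, hi⟩ := exists_nat_gt K
  have h1 := hs i
  have h2 := hK (T i) ((s i).map ⟨fun j => Nat.pair i j, fun a c h => by
    simpa using congrArg (fun z => (Nat.unpair z).2) h⟩)
  rw [Finset.sum_map] at h2
  have h3 : ∀ j, ‖(ContinuousMultilinearMap.apply 𝕂
      (fun i : Σ k : Fin m, Fin (n k) => X i.1) Y fun l => U l.1 (Nat.pair i j)) (T i)‖ ^ q
      = b i * ‖T i fun l => u i l.1 j‖ ^ q := by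
    intro j
    simp only [ContinuousMultilinearMap.apply_apply, U, Nat.unpair_pair]
    rw [(T i).map_smul_univ (fun _ => (((1 / 2 : ℝ) ^ i : ℝ) : 𝕂)) (fun l => u i l.1 j)]
    rw [Finset.prod_const, norm_smul, norm_pow, RCLike.norm_ofReal, abs_of_nonneg (by positivity),
      Real.mul_rpow (by positivity) (norm_nonneg _), Finset.card_univ]
  replace h2 := (Finset.sum_congr rfl fun j _ => (h3 j).symm).trans_le h2
  rw [← Finset.mul_sum] at h2
  have hbi := hb i
  have h4 : i * ‖T i‖ ^ q < b i * ∑ j ∈ s i, ‖T i fun l => u i l.1 j‖ ^ q := by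
    calc i * ‖T i‖ ^ q = b i * (i / b i * ‖T i‖ ^ q) := by field_simp
      _ < _ := mul_lt_mul_of_pos_left h1 hbi
  have h5 : 0 ≤ ‖T i‖ ^ q := by positivity
  nlinarith

lemma norm_le_abs_re_add_abs_im_rclike {𝕂 : Type*} [RCLike 𝕂] (z : 𝕂) :
    ‖z‖ ≤ |RCLike.re z| + |RCLike.im z| := by
  have hI : ‖(RCLike.I : 𝕂)‖ ≤ 1 := by
    rw [RCLike.norm_I]
    split_ifs <;> norm_num
  calc ‖z‖ = ‖((RCLike.re z : ℝ) : 𝕂) + (RCLike.im z : ℝ) * RCLike.I‖ := by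
        rw [RCLike.re_add_im]
    _ ≤ |RCLike.re z| + |RCLike.im z| * ‖(RCLike.I : 𝕂)‖ := by
        refine (norm_add_le _ _).trans_eq ?_
        rw [norm_mul, RCLike.norm_ofReal, RCLike.norm_ofReal]
    _ ≤ _ := by
        have := mul_le_of_le_one_right (abs_nonneg (RCLike.im z)) hI
        linarith

namespace IsNormalizedUncondBasis

variable {𝕂 : Type*} [RCLike 𝕂] {X : Type*} [NormedAddCommGroup X] [NormedSpace 𝕂 X] {e : ℕ → X}

lemma hasSum_unique (he : IsNormalizedUncondBasis 𝕂 X e) {x : X} {a b : ℕ → 𝕂}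
    (ha : HasSum (fun n => a n • e n) x) (hb : HasSum (fun n => b n • e n) x) : a = b :=
  (he.2.1 x).unique ha hb

lemma exists_norm_sum_sign_le (he : IsNormalizedUncondBasis 𝕂 X e) :
    ∃ ρ : ℝ, 1 ≤ ρ ∧
      (∀ (B : Finset ℕ) (c ε : ℕ → 𝕂), (∀ j, ε j = 1 ∨ ε j = -1) →
        ‖∑ j ∈ B, (ε j * c j) • e j‖ ≤ ρ * ‖∑ j ∈ B, c j • e j‖) ∧
      (∀ (B : Finset ℕ) (a : ℕ → 𝕂) (x : X), HasSum (fun n => a n • e n) x →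
        ‖∑ j ∈ B, a j • e j‖ ≤ ρ * ‖x‖) := by
  obtain ⟨ρ, hρ, h⟩ := he.2.2
  refine ⟨ρ, hρ, fun B c ε hε => ?_, fun B a x hx => ?_⟩
  · classical
    let c' : ℕ → 𝕂 := fun j => if j ∈ B then c j else 0
    have key : ∀ d : ℕ → 𝕂, HasSum (fun n => (d n * c' n) • e n) (∑ j ∈ B, (d j * c j) • e j) := by
      intro d
      have : ∑ j ∈ B, (d j * c j) • e j = ∑ j ∈ B, (d j * c' j) • e j :=
        Finset.sum_congr rfl fun j hj => by simp [c', hj]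
      rw [this]
      refine hasSum_sum_of_ne_finset_zero fun j hj => by simp [c', hj]
    have h1 := key (fun _ => 1)
    simp only [one_mul] at h1
    exact h c' ε _ _ hε h1 (key ε)
  · classical
    let ε : ℕ → 𝕂 := fun j => if j ∈ B then -1 else 1
    have h1 : HasSum (fun n => (ε n * a n) • e n) (x - (2 : 𝕂) • ∑ j ∈ B, a j • e j) := by
      have h2 : HasSum (fun n => if n ∈ B then a n • e n else 0) (∑ j ∈ B, a j • e j) := by
        have : ∑ j ∈ B, a j • e j = ∑ j ∈ B, if j ∈ B then a j • e j else 0 :=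
          Finset.sum_congr rfl fun j hj => by simp [hj]
        rw [this]
        exact hasSum_sum_of_ne_finset_zero fun j hj => by simp [hj]
      have h3 := hx.sub (h2.const_smul (2 : 𝕂))
      convert h3 using 2 with j
      by_cases hj : j ∈ B
      · simp only [ε, hj, if_true, two_smul, neg_mul, one_mul, neg_smul]
        abel
      · simp [ε, hj]
    have h2 := h a ε _ _ (fun j => by by_cases hj : j ∈ B <;> simp [ε, hj]) hx h1
    have h3 : ‖(2 : 𝕂) • ∑ j ∈ B, a j • e j‖
        ≤ ‖x‖ + ‖x - (2 : 𝕂) • ∑ j ∈ B, a j • e j‖ := by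
      have := norm_sub_le x (x - (2 : 𝕂) • ∑ j ∈ B, a j • e j)
      rwa [sub_sub_cancel] at this
    rw [norm_smul, RCLike.norm_ofNat] at h3
    have : ‖x‖ ≤ ρ * ‖x‖ := le_mul_of_one_le_left (norm_nonneg _) hρ
    linarith

/-- The coefficient functionals of a normalized unconditional basis, together with a constant
controlling partial sums and weak summability of `(c j • e j)`. -/
lemma exists_coord (he : IsNormalizedUncondBasis 𝕂 X e) :
    ∃ (ρ : ℝ) (f : ℕ → X →L[𝕂] 𝕂), 1 ≤ ρ ∧
      (∀ (x : X) (a : ℕ → 𝕂), HasSum (fun n => a n • e n) x → ∀ j, f j x = a j) ∧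
      (∀ (B : Finset ℕ) (x : X), ‖∑ j ∈ B, f j x • e j‖ ≤ ρ * ‖x‖) ∧
      (∀ (B : Finset ℕ) (c : ℕ → 𝕂) (φ : X →L[𝕂] 𝕂),
        ∑ j ∈ B, ‖φ (c j • e j)‖ ≤ 2 * ρ * ‖φ‖ * ‖∑ j ∈ B, c j • e j‖) := by
  obtain ⟨ρ, hρ, h1, h2⟩ := he.exists_norm_sum_sign_le
  choose a ha ha' using he.2.1
  have hadd : ∀ x y, a (x + y) = a x + a y := fun x y =>
    he.hasSum_unique (ha _) (by simpa [add_smul] using (ha x).add (ha y))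
  have hsmul : ∀ (r : 𝕂) x, a (r • x) = r • a x := fun r x =>
    he.hasSum_unique (ha _) (by simpa [mul_smul] using (ha x).const_smul r)
  let f : ℕ → X →L[𝕂] 𝕂 := fun j => LinearMap.mkContinuous
    { toFun := fun x => a x j
      map_add' := fun x y => by rw [hadd]; rfl
      map_smul' := fun r x => by rw [hsmul]; rfl } ρ fun x => by
        have := h2 {j} (a x) x (ha x)
        rw [Finset.sum_singleton, norm_smul, he.1, mul_one] at this
        exact this
  refine ⟨ρ, f, hρ, fun x b hb j => ?_, fun B x => h2 B _ x (ha x), fun B c φ => ?_⟩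
  · exact congrFun (he.hasSum_unique (ha x) hb) j
  · have key : ∀ g : 𝕂 → ℝ, (∀ z, |g z| ≤ ‖z‖) → (∀ z w, g (z + w) = g z + g w) →
        g 0 = 0 →
        ∑ j ∈ B, |g (φ (c j • e j))| ≤ ρ * ‖φ‖ * ‖∑ j ∈ B, c j • e j‖ := by
      intro g hg hga hg0
      let ε : ℕ → 𝕂 := fun j => if 0 ≤ g (φ (c j • e j)) then 1 else -1
      have hε : ∀ j, ε j = 1 ∨ ε j = -1 := fun j => by
        simp only [ε]; split_ifs <;> simp
      have h3 : ∑ j ∈ B, |g (φ (c j • e j))| = g (φ (∑ j ∈ B, (ε j * c j) • e j)) := by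
        let G : 𝕂 →+ ℝ := ⟨⟨g, hg0⟩, hga⟩
        have hG : ∀ z, g z = G z := fun _ => rfl
        rw [map_sum, hG, map_sum]
        refine Finset.sum_congr rfl fun j _ => ?_
        by_cases hj : 0 ≤ g (φ (c j • e j))
        · rw [abs_of_nonneg hj]; simp only [ε, hj, if_true, one_mul]; rfl
        · rw [abs_of_neg (not_le.1 hj)]
          simp only [ε, hj, if_false, neg_mul, one_mul, neg_smul, map_neg]
          rfl
      rw [h3]
      calc g (φ (∑ j ∈ B, (ε j * c j) • e j)) ≤ ‖φ (∑ j ∈ B, (ε j * c j) • e j)‖ :=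
            (le_abs_self _).trans (hg _)
        _ ≤ ‖φ‖ * ‖∑ j ∈ B, (ε j * c j) • e j‖ := φ.le_opNorm _
        _ ≤ ‖φ‖ * (ρ * ‖∑ j ∈ B, c j • e j‖) :=
            mul_le_mul_of_nonneg_left (h1 B c ε hε) (norm_nonneg _)
        _ = _ := by ring
    have hre := key (fun z => RCLike.re z) RCLike.abs_re_le_norm (by simp) (by simp)
    have him := key (fun z => RCLike.im z) RCLike.abs_im_le_norm (by simp) (by simp)
    calc ∑ j ∈ B, ‖φ (c j • e j)‖
        ≤ ∑ j ∈ B, (|RCLike.re (φ (c j • e j))| + |RCLike.im (φ (c j • e j))|) :=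
          Finset.sum_le_sum fun j _ => norm_le_abs_re_add_abs_im_rclike _
      _ ≤ _ := by rw [Finset.sum_add_distrib]; linarith

end IsNormalizedUncondBasis

/-- A weakly summable family of multiples of the `e j` is unconditional. -/
lemma norm_sum_mul_smul_le {𝕂 : Type*} [RCLike 𝕂] {X : Type*} [NormedAddCommGroup X]
    [NormedSpace 𝕂 X] {e : ℕ → X} {R : ℝ} {B : Finset ℕ} {c θ : ℕ → 𝕂} (hR : 0 ≤ R)
    (h : ∀ φ : X →L[𝕂] 𝕂, ∑ j ∈ B, ‖φ (c j • e j)‖ ≤ R * ‖φ‖) (hθ : ∀ j, ‖θ j‖ ≤ 1) :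
    ‖∑ j ∈ B, (θ j * c j) • e j‖ ≤ R := by
  by_cases h0 : ‖∑ j ∈ B, (θ j * c j) • e j‖ = 0
  · rw [h0]; exact hR
  obtain ⟨φ, hφ, hφx⟩ := exists_dual_vector 𝕂 _ h0
  have h1 := h φ
  rw [hφ, mul_one] at h1
  refine le_trans ?_ h1
  have h2 : ‖∑ j ∈ B, (θ j * c j) • e j‖ = ‖φ (∑ j ∈ B, (θ j * c j) • e j)‖ := by
    rw [hφx, RCLike.norm_ofReal, abs_norm]
  rw [h2, map_sum]
  refine (norm_sum_le _ _).trans (Finset.sum_le_sum fun j _ => ?_)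
  rw [mul_smul, map_smul, norm_smul]
  exact mul_le_of_le_one_left (norm_nonneg _) (hθ j)

/-- `Y` contains, uniformly in `N`, vectors `v 0, …, v (N - 1)` of norm at least `1` satisfying an
upper `ℓ_t`-estimate, i.e. `Y` finitely factors the formal inclusion `ℓ_t → ℓ_∞`. -/
def HasUpperEstimates (𝕂 : Type*) [RCLike 𝕂] (Y : Type*) [NormedAddCommGroup Y] [NormedSpace 𝕂 Y]
    (t : ℝ) : Prop :=
  ∃ C : ℝ, 0 ≤ C ∧ ∀ N : ℕ, ∃ v : ℕ → Y, (∀ j < N, 1 ≤ ‖v j‖) ∧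
    ∀ a : ℕ → 𝕂, ∑ j ∈ Finset.range N, ‖a j‖ ^ t ≤ 1 → ‖∑ j ∈ Finset.range N, a j • v j‖ ≤ C

section UpperEstimates

variable {𝕂 : Type*} [RCLike 𝕂] {Y : Type*} [NormedAddCommGroup Y] [NormedSpace 𝕂 Y]

lemma HasUpperEstimates.anti {s t : ℝ} (hs : 0 < s) (hst : s ≤ t)
    (h : HasUpperEstimates 𝕂 Y t) : HasUpperEstimates 𝕂 Y s := by
  obtain ⟨C, hC, h⟩ := h
  refine ⟨C, hC, fun N => ?_⟩
  obtain ⟨v, hv, hv'⟩ := h N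
  refine ⟨v, hv, fun a ha => hv' a (le_trans (Finset.sum_le_sum fun j hj => ?_) ha)⟩
  have h1 : ‖a j‖ ^ s ≤ 1 :=
    (Finset.single_le_sum (f := fun j => ‖a j‖ ^ s) (fun _ _ => by positivity) hj).trans ha
  have h2 : ‖a j‖ ≤ 1 := by
    by_contra hcon
    exact absurd h1 (not_le.2 (Real.one_lt_rpow (not_le.1 hcon) hs))
  rcases (norm_nonneg (a j)).eq_or_lt with h0 | h0
  · rw [← h0, Real.zero_rpow hs.ne', Real.zero_rpow (hs.trans_le hst).ne']
  · exact Real.rpow_le_rpow_of_exponent_ge h0 h2 hst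

lemma norm_sum_smul_le_mul_rpow {t C S : ℝ} (ht : 0 < t) (hS : 0 < S) {N : ℕ} {v : ℕ → Y}
    (hv : ∀ a : ℕ → 𝕂, ∑ j ∈ Finset.range N, ‖a j‖ ^ t ≤ 1 →
      ‖∑ j ∈ Finset.range N, a j • v j‖ ≤ C)
    {a : ℕ → 𝕂} (ha : ∑ j ∈ Finset.range N, ‖a j‖ ^ t ≤ S) :
    ‖∑ j ∈ Finset.range N, a j • v j‖ ≤ C * S ^ (1 / t) := by
  have hS' : 0 < S ^ (1 / t) := by positivity
  have h1 := hv (fun j => (((S ^ (1 / t))⁻¹ : ℝ) : 𝕂) * a j) (by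
    have : ∀ j, ‖(((S ^ (1 / t))⁻¹ : ℝ) : 𝕂) * a j‖ ^ t = S⁻¹ * ‖a j‖ ^ t := by
      intro j
      rw [norm_mul, RCLike.norm_ofReal, abs_of_pos (by positivity),
        Real.mul_rpow (by positivity) (norm_nonneg _), Real.inv_rpow hS'.le, ← Real.rpow_mul hS.le,
        one_div_mul_cancel ht.ne', Real.rpow_one]
    simp only [this]
    rw [← Finset.mul_sum, inv_mul_le_iff₀ hS, mul_one]
    exact ha)
  simp only [mul_smul] at h1
  rw [← Finset.smul_sum, norm_smul, RCLike.norm_ofReal, abs_of_pos (by positivity),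
    inv_mul_le_iff₀ hS'] at h1
  linarith

end UpperEstimates

section Diagonal

variable {𝕂 : Type*} [RCLike 𝕂] {Y : Type*} [NormedAddCommGroup Y] [NormedSpace 𝕂 Y]
  {m : ℕ} {n : Fin m → ℕ} {X : Fin m → Type*} [∀ k, NormedAddCommGroup (X k)]
  [∀ k, NormedSpace 𝕂 (X k)]

/-- The multilinear map `x ↦ ∑ j < N, (∏ i, f j (x i)) • v j`. -/
noncomputable def diagonalMap (f : ∀ k, ℕ → X k →L[𝕂] 𝕂) (v : ℕ → Y) (N : ℕ) :
    ContinuousMultilinearMap 𝕂 (fun i : Σ k : Fin m, Fin (n k) => X i.1) Y :=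
  ∑ j ∈ Finset.range N, ((ContinuousMultilinearMap.mkPiAlgebra 𝕂 (Σ k : Fin m, Fin (n k))
    𝕂).compContinuousLinearMap fun i => f i.1 j).smulRight (v j)

lemma diagonalMap_apply (f : ∀ k, ℕ → X k →L[𝕂] 𝕂) (v : ℕ → Y) (N : ℕ)
    (x : ∀ i : Σ k : Fin m, Fin (n k), X i.1) :
    diagonalMap f v N x = ∑ j ∈ Finset.range N, (∏ i, f i.1 j (x i)) • v j := by
  simp [diagonalMap]

/-- Products of coefficients of different vectors are dominated by products of coefficients of
one vector from each space. -/
lemma exists_dominating_vectors {e : ∀ k, ℕ → X k} {f : ∀ k, ℕ → X k →L[𝕂] 𝕂} {R : ℝ} (hR : 1 ≤ R)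
    (hf1 : ∀ k (B : Finset ℕ) x, ‖∑ j ∈ B, f k j x • e k j‖ ≤ R * ‖x‖)
    (hf2 : ∀ k (B : Finset ℕ) (c : ℕ → 𝕂) (φ : X k →L[𝕂] 𝕂),
      ∑ j ∈ B, ‖φ (c j • e k j)‖ ≤ 2 * R * ‖φ‖ * ‖∑ j ∈ B, c j • e k j‖)
    (hfe : ∀ k i j, f k i (e k j) = if i = j then 1 else 0) (N : ℕ)
    (x : ∀ i : Σ k : Fin m, Fin (n k), X i.1) (hx : ∀ i, ‖x i‖ ≤ 1) :
    ∃ y : ∀ k, X k, (∀ k, ‖y k‖ ≤ 2 * R ^ 2 * n k) ∧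
      ∀ j < N, ∏ i, ‖f i.1 j (x i)‖ ≤
        ∏ i : Σ k : Fin m, Fin (n k), ‖f i.1 j (y i.1)‖ := by
  refine ⟨fun k => ∑ l : Fin (n k), ∑ j ∈ Finset.range N,
    ((‖f k j (x ⟨k, l⟩)‖ : ℝ) : 𝕂) • e k j, fun k => ?_, fun j hj => ?_⟩
  · refine (norm_sum_le _ _).trans ?_
    have : ∀ l : Fin (n k), ‖∑ j ∈ Finset.range N,
        ((‖f k j (x ⟨k, l⟩)‖ : ℝ) : 𝕂) • e k j‖ ≤ 2 * R ^ 2 := by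
      intro l
      have h1 : ∀ j, ∃ θ : 𝕂, ‖θ‖ ≤ 1 ∧
          ((‖f k j (x ⟨k, l⟩)‖ : ℝ) : 𝕂) = θ * f k j (x ⟨k, l⟩) := by
        intro j
        by_cases h0 : f k j (x ⟨k, l⟩) = 0
        · exact ⟨0, by simp, by simp [h0]⟩
        · refine ⟨((‖f k j (x ⟨k, l⟩)‖ : ℝ) : 𝕂) / f k j (x ⟨k, l⟩), ?_, ?_⟩
          · simp [h0]
          · field_simp
      choose θ hθ hθ' using h1
      simp only [hθ']
      refine norm_sum_mul_smul_le (by positivity) (fun φ => ?_) hθ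
      refine (hf2 k _ _ φ).trans ?_
      have h2 := (hf1 k (Finset.range N) (x ⟨k, l⟩)).trans
        (mul_le_of_le_one_right (by positivity) (hx ⟨k, l⟩))
      calc 2 * R * ‖φ‖ * ‖∑ j ∈ Finset.range N, f k j (x ⟨k, l⟩) • e k j‖
          ≤ 2 * R * ‖φ‖ * R := mul_le_mul_of_nonneg_left h2 (by positivity)
        _ = _ := by ring
    refine (Finset.sum_le_sum fun l _ => this l).trans_eq ?_
    simp [mul_comm]
  · refine Finset.prod_le_prod (fun _ _ => norm_nonneg _) fun i _ => ?_
    obtain ⟨k, l⟩ := i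
    have h1 : f k j (∑ l : Fin (n k), ∑ j ∈ Finset.range N,
        ((‖f k j (x ⟨k, l⟩)‖ : ℝ) : 𝕂) • e k j)
        = ((∑ l : Fin (n k), ‖f k j (x ⟨k, l⟩)‖ : ℝ) : 𝕂) := by
      simp [map_sum, hfe, hj]
    change ‖f k j (x ⟨k, l⟩)‖ ≤ ‖f k j (∑ l : Fin (n k), ∑ j ∈ Finset.range N,
        ((‖f k j (x ⟨k, l⟩)‖ : ℝ) : 𝕂) • e k j)‖
    rw [h1, RCLike.norm_ofReal, abs_of_nonneg (Finset.sum_nonneg fun _ _ => norm_nonneg _)]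
    exact Finset.single_le_sum (f := fun l => ‖f k j (x ⟨k, l⟩)‖) (fun _ _ => norm_nonneg _)
      (Finset.mem_univ l)

lemma norm_diagonalMap_le {e : ∀ k, ℕ → X k} {f : ∀ k, ℕ → X k →L[𝕂] 𝕂} {R : ℝ} (hR : 1 ≤ R)
    (hf1 : ∀ k (B : Finset ℕ) x, ‖∑ j ∈ B, f k j x • e k j‖ ≤ R * ‖x‖)
    (hf2 : ∀ k (B : Finset ℕ) (c : ℕ → 𝕂) (φ : X k →L[𝕂] 𝕂),
      ∑ j ∈ B, ‖φ (c j • e k j)‖ ≤ 2 * R * ‖φ‖ * ‖∑ j ∈ B, c j • e k j‖)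
    (hfe : ∀ k i j, f k i (e k j) = if i = j then 1 else 0) {N : ℕ} {t C S A : ℝ}
    (ht : 0 < t) (hC : 0 ≤ C) (hS : 0 < S) (hA : 0 < A) (hAn : ∀ k, 2 * R ^ 2 * n k ≤ A) {v : ℕ → Y}
    (hv : ∀ a : ℕ → 𝕂, ∑ j ∈ Finset.range N, ‖a j‖ ^ t ≤ 1 →
      ‖∑ j ∈ Finset.range N, a j • v j‖ ≤ C)
    (hw : ∀ x : ∀ k, X k, (∀ k, ‖x k‖ ≤ 1) → ∑ j ∈ Finset.range N,
      (∏ i : Σ k : Fin m, Fin (n k), ‖f i.1 j (x i.1)‖) ^ t ≤ S) :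
    ‖diagonalMap (n := n) f v N‖ ≤
      C * (A ^ Fintype.card (Σ k : Fin m, Fin (n k)) * S ^ (1 / t)) := by
  set D := Fintype.card (Σ k : Fin m, Fin (n k)) with hD
  have hunit : ∀ x : ∀ i : Σ k : Fin m, Fin (n k), X i.1, (∀ i, ‖x i‖ ≤ 1) →
      ‖diagonalMap f v N x‖ ≤ C * (A ^ D * S ^ (1 / t)) := by
    intro x hx
    obtain ⟨y, hy, hxy⟩ := exists_dominating_vectors hR hf1 hf2 hfe N x hx
    have h1 := hw (fun k => ((A⁻¹ : ℝ) : 𝕂) • y k) fun k => by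
      rw [norm_smul, RCLike.norm_ofReal, abs_of_pos (by positivity), inv_mul_le_iff₀ hA, mul_one]
      exact (hy k).trans (hAn k)
    have h2 : ∑ j ∈ Finset.range N, ‖∏ i, f i.1 j (x i)‖ ^ t ≤ (A ^ D) ^ t * S := by
      refine le_trans ?_ (mul_le_mul_of_nonneg_left h1 (by positivity))
      rw [Finset.mul_sum]
      refine Finset.sum_le_sum fun j hj => ?_
      rw [← Real.mul_rpow (by positivity) (by positivity), norm_prod]
      refine Real.rpow_le_rpow (by positivity) ?_ ht.le
      refine (hxy j (Finset.mem_range.1 hj)).trans_eq ?_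
      simp only [map_smul, norm_smul, RCLike.norm_ofReal, Finset.prod_mul_distrib, Finset.prod_const,
        Finset.card_univ]
      rw [← hD, abs_of_pos (by positivity), ← mul_assoc, ← mul_pow, mul_inv_cancel₀ hA.ne', one_pow,
        one_mul]
    have h3 := norm_sum_smul_le_mul_rpow ht (by positivity) hv h2
    rw [diagonalMap_apply]
    refine h3.trans_eq ?_
    rw [Real.mul_rpow (by positivity) hS.le, ← Real.rpow_mul (by positivity),
      mul_one_div_cancel ht.ne', Real.rpow_one]
  refine ContinuousMultilinearMap.opNorm_le_bound (by positivity) fun x => ?_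
  by_cases h0 : ∃ i, x i = 0
  · obtain ⟨i, hi⟩ := h0
    rw [ContinuousMultilinearMap.map_coord_zero _ i hi, norm_zero]
    positivity
  · push Not at h0
    have h1 : x = fun i => ((‖x i‖ : ℝ) : 𝕂) • (((‖x i‖⁻¹ : ℝ) : 𝕂) • x i) := by
      funext i
      have : ‖x i‖ ≠ 0 := norm_ne_zero_iff.2 (h0 i)
      rw [smul_smul, ← RCLike.ofReal_mul, mul_inv_cancel₀ this, RCLike.ofReal_one, one_smul]
    have h2 := hunit (fun i => (((‖x i‖⁻¹ : ℝ) : 𝕂) • x i)) fun i => by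
      have : ‖x i‖ ≠ 0 := norm_ne_zero_iff.2 (h0 i)
      rw [norm_smul, RCLike.norm_ofReal, abs_of_nonneg (by positivity), inv_mul_cancel₀ this]
    conv_lhs => rw [h1]
    rw [ContinuousMultilinearMap.map_smul_univ, norm_smul, norm_prod]
    simp only [RCLike.norm_ofReal, abs_norm]
    rw [mul_comm]
    exact mul_le_mul_of_nonneg_right h2 (by positivity)

/-- The key self-improving estimate. -/
lemma exists_sum_prod_coord_le {e : ∀ k, ℕ → X k} {f : ∀ k, ℕ → X k →L[𝕂] 𝕂} {R : ℝ} (hR : 1 ≤ R)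
    (he : ∀ k j, ‖e k j‖ = 1)
    (hf1 : ∀ k (B : Finset ℕ) x, ‖∑ j ∈ B, f k j x • e k j‖ ≤ R * ‖x‖)
    (hf2 : ∀ k (B : Finset ℕ) (c : ℕ → 𝕂) (φ : X k →L[𝕂] 𝕂),
      ∑ j ∈ B, ‖φ (c j • e k j)‖ ≤ 2 * R * ‖φ‖ * ‖∑ j ∈ B, c j • e k j‖)
    (hfe : ∀ k i j, f k i (e k j) = if i = j then 1 else 0)
    (hne : Nonempty (Σ k : Fin m, Fin (n k))) {q t K : ℝ} (hq : 0 < q) (hqt : q < t) (hK0 : 0 ≤ K)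
    (hK : ∀ (T : ContinuousMultilinearMap 𝕂 (fun i : Σ k : Fin m, Fin (n k) => X i.1) Y)
        (u : ∀ k, ℕ → X k),
        (∀ k (φ : X k →L[𝕂] 𝕂) (s : Finset ℕ), ∑ j ∈ s, ‖φ (u k j)‖ ≤ ‖φ‖) →
        ∀ s : Finset ℕ, ∑ j ∈ s, ‖T fun i => u i.1 j‖ ^ q ≤ K * ‖T‖ ^ q)
    (hY : HasUpperEstimates 𝕂 Y t) :
    ∃ S₀ : ℝ, ∀ (N : ℕ) (x : ∀ k, X k), (∀ k, ‖x k‖ ≤ 1) → ∑ j ∈ Finset.range N,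
      (∏ i : Σ k : Fin m, Fin (n k), ‖f i.1 j (x i.1)‖) ^ t ≤ S₀ := by
  obtain ⟨C, hC, hY⟩ := hY
  have ht : 0 < t := hq.trans hqt
  set D := Fintype.card (Σ k : Fin m, Fin (n k)) with hD
  set A : ℝ := ∑ k, 2 * R ^ 2 * n k + 1 with hA
  have hA0 : 0 < A := by positivity
  have hAn : ∀ k, 2 * R ^ 2 * n k ≤ A := fun k => by
    have := Finset.single_le_sum (f := fun k => 2 * R ^ 2 * (n k : ℝ)) (fun _ _ => by positivity)
      (Finset.mem_univ k)
    linarith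
  set K₂ : ℝ := (R ^ D) ^ (t - q) * (((2 * R ^ 2) ^ D) ^ q * (K * (C * A ^ D) ^ q)) with hK₂
  have hK₂0 : 0 ≤ K₂ := by positivity
  refine ⟨max 1 (K₂ ^ (1 - q / t)⁻¹), fun N => ?_⟩
  obtain ⟨v, hv1, hv2⟩ := hY N
  let w : (∀ k, X k) → ℕ → ℝ := fun x j => ∏ i : Σ k : Fin m, Fin (n k), ‖f i.1 j (x i.1)‖
  have hw0 : ∀ x j, 0 ≤ w x j := fun x j => Finset.prod_nonneg fun _ _ => norm_nonneg _
  have hwR : ∀ x, (∀ k, ‖x k‖ ≤ 1) → ∀ j, w x j ≤ R ^ D := by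
    intro x hx j
    calc w x j ≤ ∏ i : Σ k : Fin m, Fin (n k), R := by
          refine Finset.prod_le_prod (fun _ _ => norm_nonneg _) fun i _ => ?_
          have := hf1 i.1 {j} (x i.1)
          rw [Finset.sum_singleton, norm_smul, he, mul_one] at this
          exact this.trans (mul_le_of_le_one_right (by positivity) (hx _))
      _ = R ^ D := by rw [Finset.prod_const, Finset.card_univ]
  let Ω : Set ℝ := (fun x => ∑ j ∈ Finset.range N, w x j ^ t) '' {x | ∀ k, ‖x k‖ ≤ 1}
  have hbdd : BddAbove Ω := by
    refine ⟨∑ j ∈ Finset.range N, (R ^ D) ^ t, ?_⟩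
    rintro _ ⟨x, hx, rfl⟩
    exact Finset.sum_le_sum fun j _ => Real.rpow_le_rpow (hw0 x j) (hwR x hx j) ht.le
  have hΩ : Ω.Nonempty := ⟨_, 0, fun k => by simp, rfl⟩
  set S := sSup Ω with hS
  have hSx : ∀ x : ∀ k, X k, (∀ k, ‖x k‖ ≤ 1) → ∑ j ∈ Finset.range N, w x j ^ t ≤ S :=
    fun x hx => le_csSup hbdd ⟨x, hx, rfl⟩
  suffices hfin : S ≤ max 1 (K₂ ^ (1 - q / t)⁻¹) from fun x hx => (hSx x hx).trans hfin
  rcases le_or_gt S 1 with hS1 | hS1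
  · exact hS1.trans (le_max_left _ _)
  refine le_trans ?_ (le_max_right _ _)
  have hS0 : 0 < S := one_pos.trans hS1
  have hT := norm_diagonalMap_le hR hf1 hf2 hfe ht hC hS0 hA0 hAn hv2 hSx
  have hstep : S ≤ K₂ * S ^ (q / t) := by
    refine csSup_le hΩ ?_
    rintro _ ⟨x, hx, rfl⟩
    have h1 := hK (diagonalMap f v N) (fun k j => ((((2 * R ^ 2)⁻¹ : ℝ) : 𝕂) * f k j (x k)) • e k j)
      (fun k φ s => by
        have h2 := (hf2 k s (fun j => f k j (x k)) φ).trans (mul_le_mul_of_nonneg_left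
          ((hf1 k s (x k)).trans (mul_le_of_le_one_right (by positivity) (hx k))) (by positivity))
        simp only [mul_smul, map_smul φ (((2 * R ^ 2)⁻¹ : ℝ) : 𝕂)]
        simp only [norm_smul (((2 * R ^ 2)⁻¹ : ℝ) : 𝕂)]
        rw [← Finset.mul_sum, RCLike.norm_ofReal, abs_of_pos (by positivity),
          inv_mul_le_iff₀ (by positivity)]
        refine h2.trans_eq (by ring)) (Finset.range N)
    have h3 : ∀ j ∈ Finset.range N, w x j ^ q ≤ ((2 * R ^ 2) ^ D) ^ q *
        ‖diagonalMap f v N (fun i : Σ k : Fin m, Fin (n k) =>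
          ((((2 * R ^ 2)⁻¹ : ℝ) : 𝕂) * f i.1 j (x i.1)) • e i.1 j)‖ ^ q := by
      intro j hj
      rw [← Real.mul_rpow (by positivity) (norm_nonneg _)]
      refine Real.rpow_le_rpow (hw0 x j) ?_ hq.le
      rw [diagonalMap_apply, Finset.sum_eq_single_of_mem j hj]
      · simp only [map_smul, hfe, if_true, smul_eq_mul, mul_one, norm_smul, norm_prod, norm_mul, norm_pow,
          RCLike.norm_ofReal, Finset.prod_mul_distrib, Finset.prod_const, Finset.card_univ]
        rw [abs_of_pos (by positivity), ← mul_assoc, ← mul_assoc, ← mul_pow,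
          mul_inv_cancel₀ (by positivity), one_pow, one_mul]
        exact le_mul_of_one_le_right (hw0 x j) (hv1 j (Finset.mem_range.1 hj))
      · intro l _ hl
        obtain ⟨i⟩ := hne
        rw [Finset.prod_eq_zero (Finset.mem_univ i), zero_smul]
        simp [hfe, hl]
    have h4 : ∑ j ∈ Finset.range N, w x j ^ q
        ≤ ((2 * R ^ 2) ^ D) ^ q * (K * (C * (A ^ D * S ^ (1 / t))) ^ q) := by
      refine (Finset.sum_le_sum h3).trans ?_
      rw [← Finset.mul_sum]
      refine mul_le_mul_of_nonneg_left (h1.trans ?_) (by positivity)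
      exact mul_le_mul_of_nonneg_left (Real.rpow_le_rpow (norm_nonneg _) hT hq.le) hK0
    have h5 : ∀ j, w x j ^ t ≤ (R ^ D) ^ (t - q) * w x j ^ q := by
      intro j
      rcases (hw0 x j).eq_or_lt with h0 | h0
      · rw [← h0, Real.zero_rpow ht.ne', Real.zero_rpow hq.ne', mul_zero]
      · calc w x j ^ t = w x j ^ (t - q) * w x j ^ q := by
              rw [← Real.rpow_add h0, sub_add_cancel]
          _ ≤ _ := mul_le_mul_of_nonneg_right
              (Real.rpow_le_rpow h0.le (hwR x hx j) (by linarith)) (by positivity)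
    calc ∑ j ∈ Finset.range N, w x j ^ t
        ≤ (R ^ D) ^ (t - q) * ∑ j ∈ Finset.range N, w x j ^ q := by
          rw [Finset.mul_sum]; exact Finset.sum_le_sum fun j _ => h5 j
      _ ≤ (R ^ D) ^ (t - q) * (((2 * R ^ 2) ^ D) ^ q * (K * (C * (A ^ D * S ^ (1 / t))) ^ q)) :=
          mul_le_mul_of_nonneg_left h4 (by positivity)
      _ = K₂ * S ^ (q / t) := by
          rw [← mul_assoc C, Real.mul_rpow (by positivity) (by positivity) (z := q),
            ← Real.rpow_mul hS0.le, one_div_mul_eq_div, hK₂]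
          ring
  have hqt1 : 0 < 1 - q / t := by
    rw [sub_pos, div_lt_one ht]; exact hqt
  have h6 : S ^ (1 - q / t) ≤ K₂ := by
    rw [Real.rpow_sub hS0, Real.rpow_one, div_le_iff₀ (by positivity)]
    exact hstep
  calc S = (S ^ (1 - q / t)) ^ (1 - q / t)⁻¹ := by
        rw [← Real.rpow_mul hS0.le, mul_inv_cancel₀ hqt1.ne', Real.rpow_one]
    _ ≤ _ := Real.rpow_le_rpow (by positivity) h6 (by positivity)

end Diagonal

section DvoretzkyRogers

variable {𝕂 : Type*} [RCLike 𝕂] {Y : Type*} [NormedAddCommGroup Y] [NormedSpace 𝕂 Y]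
  {E : Type*} [NormedAddCommGroup E] [InnerProductSpace 𝕂 E] [FiniteDimensional 𝕂 E]

lemma det_smul_id_add_smul_starProjection (F : Submodule 𝕂 E) (α β : 𝕂) :
    (β • (1 : E →L[𝕂] E) + (α - β) • F.starProjection).det =
      α ^ Module.finrank 𝕂 F * β ^ Module.finrank 𝕂 (E ⧸ F) := by
  set L : E →ₗ[𝕂] E :=
    ((β • (1 : E →L[𝕂] E) + (α - β) • F.starProjection : E →L[𝕂] E) : E →ₗ[𝕂] E) with hL
  have hLx : ∀ x, L x = β • x + (α - β) • F.starProjection x := fun x => by simp [hL]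
  have hF : F ≤ F.comap L := fun x hx => by
    rw [Submodule.mem_comap, hLx]
    exact F.add_mem (F.smul_mem _ hx) (F.smul_mem _ (F.starProjection_apply_mem x))
  have h1 : L.restrict hF = α • LinearMap.id := by
    ext x
    rw [LinearMap.coe_restrict_apply, hLx, Submodule.starProjection_eq_self_iff.2 x.2, ← add_smul]
    simp
  have h2 : F.mapQ F L hF = β • LinearMap.id := by
    refine LinearMap.ext fun y => ?_
    obtain ⟨x, rfl⟩ := F.mkQ_surjective y
    have : F.mkQ (F.starProjection x) = 0 := by
      rw [Submodule.mkQ_apply, Submodule.Quotient.mk_eq_zero]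
      exact F.starProjection_apply_mem x
    rw [Submodule.mkQ_apply, Submodule.mapQ_apply, ← Submodule.mkQ_apply, hLx, map_add, map_smul,
      map_smul, this]
    simp
  change LinearMap.det L = _
  rw [LinearMap.det_eq_det_mul_det F L hF, h1, h2, LinearMap.det_smul, LinearMap.det_smul]
  simp

/-- If `A` maximises the determinant among the endomorphisms with `‖u ∘ A‖ ≤ 1`, then every
subspace of more than half the dimension contains a unit vector on which `u ∘ A` is large. -/
lemma exists_norm_ge_half_of_det_maximal (u : E →L[𝕂] Y) (A : E →L[𝕂] E) (hA : ‖u.comp A‖ ≤ 1)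
    (hA0 : A.det ≠ 0) (hmax : ∀ B : E →L[𝕂] E, ‖u.comp B‖ ≤ 1 → ‖B.det‖ ≤ ‖A.det‖)
    (F : Submodule 𝕂 E) (hF : Module.finrank 𝕂 E < 2 * Module.finrank 𝕂 F) :
    ∃ x ∈ F, ‖x‖ = 1 ∧ 1 / 2 ≤ ‖u (A x)‖ := by
  by_contra! hcon
  have hF' : ∀ x ∈ F, ‖u (A x)‖ ≤ 1 / 2 * ‖x‖ := by
    intro x hx
    by_cases h0 : x = 0
    · simp [h0]
    have h0' : 0 < ‖x‖ := norm_pos_iff.2 h0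
    have := hcon (((‖x‖⁻¹ : ℝ) : 𝕂) • x) (F.smul_mem _ hx)
      (by rw [norm_smul, RCLike.norm_ofReal, abs_of_nonneg (by positivity),
        inv_mul_cancel₀ h0'.ne'])
    rw [map_smul, map_smul, norm_smul, RCLike.norm_ofReal, abs_of_nonneg (by positivity),
      inv_mul_lt_iff₀ h0'] at this
    linarith
  set r : ℝ := Real.sqrt 2 with hr
  have hr0 : 0 < r := by positivity
  have hr2 : r ^ 2 = 2 := Real.sq_sqrt (by norm_num)
  set L : E →L[𝕂] E := ((r⁻¹ : ℝ) : 𝕂) • (1 : E →L[𝕂] E) +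
    ((r : 𝕂) - ((r⁻¹ : ℝ) : 𝕂)) • F.starProjection with hL
  have hLdet := det_smul_id_add_smul_starProjection F (r : 𝕂) ((r⁻¹ : ℝ) : 𝕂)
  rw [← hL] at hLdet
  have h1 : ‖u.comp (A.comp L)‖ ≤ 1 := by
    refine ContinuousLinearMap.opNorm_le_bound _ zero_le_one fun x => ?_
    have hx : L x = ((r⁻¹ : ℝ) : 𝕂) • Fᗮ.starProjection x + (r : 𝕂) • F.starProjection x := by
      have : Fᗮ.starProjection x = x - F.starProjection x := by
        rw [Submodule.starProjection_orthogonal]; rfl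
      simp only [hL, this, add_apply, smul_apply, sub_smul, smul_sub, one_apply_eq_self, sub_apply]
      abel
    set p := F.starProjection x
    set p' := Fᗮ.starProjection x
    have hp : ‖u (A p)‖ ≤ 1 / 2 * ‖p‖ := hF' _ (F.starProjection_apply_mem x)
    have hp' : ‖u (A p')‖ ≤ ‖p'‖ := ((u.comp A).le_of_opNorm_le hA p').trans_eq (one_mul _)
    have hxx : ‖x‖ ^ 2 = ‖p‖ ^ 2 + ‖p'‖ ^ 2 := Submodule.norm_sq_eq_add_norm_sq_starProjection x F
    rw [ContinuousLinearMap.comp_apply, ContinuousLinearMap.comp_apply, hx, map_add, map_add,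
      map_smul, map_smul, map_smul, map_smul]
    refine (norm_add_le _ _).trans ?_
    rw [norm_smul, norm_smul, RCLike.norm_ofReal, RCLike.norm_ofReal, abs_of_pos hr0,
      abs_of_pos (inv_pos.2 hr0), one_mul]
    have h2 : r⁻¹ * ‖u (A p')‖ + r * ‖u (A p)‖ ≤ r⁻¹ * (‖p'‖ + ‖p‖) := by
      have : r * ‖u (A p)‖ ≤ r⁻¹ * ‖p‖ := by
        rw [le_inv_mul_iff₀ hr0, ← mul_assoc, ← sq, hr2]
        linarith
      have : r⁻¹ * ‖u (A p')‖ ≤ r⁻¹ * ‖p'‖ := by gcongr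
      linarith
    refine h2.trans ?_
    rw [inv_mul_le_iff₀ hr0]
    refine abs_le_of_sq_le_sq' ?_ (by positivity) |>.2
    rw [mul_pow, hr2, hxx]
    nlinarith [sq_nonneg (‖p‖ - ‖p'‖)]
  have h2 := hmax _ h1
  have h3 : (A.comp L).det = A.det * L.det := LinearMap.det_comp _ _
  rw [h3, norm_mul, hLdet, norm_mul, norm_pow, norm_pow, RCLike.norm_ofReal, RCLike.norm_ofReal,
    abs_of_pos hr0, abs_of_pos (inv_pos.2 hr0)] at h2
  have h4 : r ^ Module.finrank 𝕂 F * r⁻¹ ^ Module.finrank 𝕂 (E ⧸ F) ≤ 1 := by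
    have := norm_pos_iff.2 hA0
    by_contra hc
    push Not at hc
    nlinarith
  have h5 := F.finrank_quotient_add_finrank
  rw [inv_pow, ← div_eq_mul_inv, div_le_one (by positivity)] at h4
  have h6 : r ^ Module.finrank 𝕂 (E ⧸ F) < r ^ Module.finrank 𝕂 F := by
    refine pow_lt_pow_right₀ ?_ (by omega)
    rw [hr]
    exact Real.lt_sqrt_of_sq_lt (by norm_num)
  linarith

lemma exists_det_maximal (u : E →L[𝕂] Y) (hu : Function.Injective u) :
    ∃ A : E →L[𝕂] E, ‖u.comp A‖ ≤ 1 ∧ A.det ≠ 0 ∧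
      ∀ B : E →L[𝕂] E, ‖u.comp B‖ ≤ 1 → ‖B.det‖ ≤ ‖A.det‖ := by
  have : ProperSpace (E →L[𝕂] E) := FiniteDimensional.proper 𝕂 _
  obtain ⟨c, hc0, hc⟩ := LinearMap.exists_antilipschitzWith (u : E →ₗ[𝕂] Y)
    (LinearMap.ker_eq_bot.2 hu)
  have hcont : Continuous fun B : E →L[𝕂] E => ‖u.comp B‖ :=
    ((ContinuousLinearMap.compL 𝕂 E E Y u).continuous).norm
  have hcomp : IsCompact {B : E →L[𝕂] E | ‖u.comp B‖ ≤ 1} := by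
    refine (isCompact_closedBall (0 : E →L[𝕂] E) (c : ℝ)).of_isClosed_subset
      (isClosed_le hcont continuous_const) fun B hB => ?_
    rw [mem_closedBall_zero_iff]
    refine ContinuousLinearMap.opNorm_le_bound _ c.2 fun x => ?_
    have h1 : ‖B x‖ ≤ c * ‖u (B x)‖ := by
      simpa using hc.le_mul_dist (B x) 0
    refine h1.trans (mul_le_mul_of_nonneg_left ?_ c.2)
    exact ((u.comp B).le_of_opNorm_le hB x).trans_eq (one_mul _)
  set δ : ℝ := (1 + ‖u‖)⁻¹ with hδ
  have hδ0 : 0 < δ := by positivity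
  have hB₀ : ‖u.comp ((δ : 𝕂) • ContinuousLinearMap.id 𝕂 E)‖ ≤ 1 := by
    refine ContinuousLinearMap.opNorm_le_bound _ zero_le_one fun x => ?_
    rw [ContinuousLinearMap.comp_apply, smul_apply, map_smul, norm_smul,
      RCLike.norm_ofReal, abs_of_pos hδ0, hδ, inv_mul_le_iff₀ (by positivity), one_mul]
    refine (u.le_opNorm x).trans ?_
    gcongr
    linarith
  obtain ⟨A, hA, hA'⟩ := hcomp.exists_isMaxOn ⟨_, hB₀⟩
    (ContinuousLinearMap.continuous_det (𝕜 := 𝕂) (E := E)).norm.continuousOn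
  refine ⟨A, hA, ?_, fun B hB => hA' hB⟩
  have h2 := hA' hB₀
  have h3 : ((δ : 𝕂) • ContinuousLinearMap.id 𝕂 E).det ≠ 0 := by
    change LinearMap.det ((δ : 𝕂) • (LinearMap.id : E →ₗ[𝕂] E)) ≠ 0
    rw [LinearMap.det_smul, LinearMap.det_id, mul_one]
    exact pow_ne_zero _ (by exact_mod_cast hδ0.ne')
  exact norm_pos_iff.1 ((norm_pos_iff.2 h3).trans_le h2)

/-- The Dvoretzky–Rogers lemma. -/
theorem hasUpperEstimates_two (hY : ¬FiniteDimensional 𝕂 Y) : HasUpperEstimates 𝕂 Y 2 := by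
  refine ⟨2, by norm_num, fun N => ?_⟩
  obtain ⟨b, hb⟩ : ∃ b : Fin (2 * N) → Y, LinearIndependent 𝕂 b := by
    refine exists_linearIndependent_of_le_rank ?_
    refine (Cardinal.natCast_lt_aleph0.le).trans ?_
    rw [← not_lt, Module.rank_lt_aleph0_iff]
    exact hY
  let u : EuclideanSpace 𝕂 (Fin (2 * N)) →L[𝕂] Y := LinearMap.toContinuousLinearMap
    ((Fintype.linearCombination 𝕂 b).comp (WithLp.linearEquiv 2 𝕂 (Fin (2 * N) → 𝕂)).toLinearMap)
  have hu : Function.Injective u := by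
    have := (linearIndependent_iff_injective_fintypeLinearCombination.1 hb).comp
      (WithLp.linearEquiv 2 𝕂 (Fin (2 * N) → 𝕂)).injective
    exact this
  obtain ⟨A, hA, hA0, hmax⟩ := exists_det_maximal u hu
  have hgreedy : ∀ j ≤ N, ∃ x : Fin j → EuclideanSpace 𝕂 (Fin (2 * N)),
      Orthonormal 𝕂 x ∧ ∀ i, 1 / 2 ≤ ‖u (A (x i))‖ := by
    intro j
    induction j with
    | zero => exact fun _ => ⟨Fin.elim0, .of_isEmpty _, fun i => i.elim0⟩
    | succ j ih =>
      intro hj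
      obtain ⟨x, hx, hx'⟩ := ih (by omega)
      have h1 := finrank_range_le_card (R := 𝕂) x
      have h2 := (Submodule.span 𝕂 (Set.range x)).finrank_add_finrank_orthogonal
      rw [finrank_euclideanSpace_fin] at h2
      rw [Fintype.card_fin] at h1
      obtain ⟨y, hyF, hy1, hy⟩ := exists_norm_ge_half_of_det_maximal u A hA hA0 hmax
        (Submodule.span 𝕂 (Set.range x))ᗮ (by
          rw [finrank_euclideanSpace_fin]
          change Module.finrank 𝕂 (Submodule.span 𝕂 (Set.range x)) ≤ j at h1
          omega)
      refine ⟨Matrix.vecCons y x, ?_, fun i => ?_⟩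
      · rw [orthonormal_vecCons_iff]
        refine ⟨hy1, fun i => ?_, hx⟩
        exact (Submodule.mem_orthogonal' _ _).1 hyF _ (Submodule.subset_span ⟨i, rfl⟩)
      · refine Fin.cases ?_ (fun i => ?_) i
        · simpa using hy
        · simpa using hx' i
  obtain ⟨x, hx, hx'⟩ := hgreedy N le_rfl
  refine ⟨fun j => if h : j < N then (2 : 𝕂) • u (A (x ⟨j, h⟩)) else 0, fun j hj => ?_,
    fun a ha => ?_⟩
  · simp only [hj, dif_pos]
    rw [norm_smul, RCLike.norm_two]
    linarith [hx' ⟨j, hj⟩]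
  · rw [Finset.sum_range] at ha ⊢
    simp only [Fin.is_lt, dif_pos, Fin.eta]
    have h1 : ∑ i : Fin N, a i • (2 : 𝕂) • u (A (x i)) =
        (2 : 𝕂) • u.comp A (∑ i : Fin N, a i • x i) := by
      rw [map_sum, Finset.smul_sum]
      refine Finset.sum_congr rfl fun i _ => ?_
      rw [map_smul, smul_comm]; rfl
    have h2 : ‖∑ i : Fin N, a i • x i‖ ^ 2 ≤ 1 := by
      have := hx.orthogonalFamily.norm_sum (fun i => a i) Finset.univ
      simp only [LinearIsometry.toSpanSingleton_apply] at this
      rw [this]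
      simpa using ha
    rw [h1, norm_smul, RCLike.norm_two]
    have h3 := (u.comp A).le_of_opNorm_le hA (∑ i : Fin N, a i • x i)
    have h4 : ‖∑ i : Fin N, a i • x i‖ ≤ 1 := by
      have := norm_nonneg (∑ i : Fin N, a i • x i)
      nlinarith
    linarith

end DvoretzkyRogers

section WeakToStrong

lemma exists_dyadic_level {x : ℝ} (h0 : 0 < x) (h1 : x ≤ 1) :
    ∃ l : ℕ, (2⁻¹ : ℝ) ^ (l + 1) ≤ x ∧ x ≤ (2⁻¹ : ℝ) ^ l := by
  have h2 : 0 ≤ -Real.logb 2 x := by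
    rw [neg_nonneg]
    exact Real.logb_nonpos (by norm_num) h0.le h1
  have h4 : x = (2⁻¹ : ℝ) ^ (-Real.logb 2 x) := by
    rw [Real.inv_rpow (by norm_num), Real.rpow_neg (by norm_num), inv_inv,
      Real.rpow_logb (by norm_num) (by norm_num) h0]
  refine ⟨⌊-Real.logb 2 x⌋₊, ?_, ?_⟩
  · conv_rhs => rw [h4]
    rw [← Real.rpow_natCast]
    refine Real.rpow_le_rpow_of_exponent_ge (by norm_num) (by norm_num) ?_
    push_cast
    exact (Nat.lt_floor_add_one _).le
  · conv_lhs => rw [h4]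
    rw [← Real.rpow_natCast]
    exact Real.rpow_le_rpow_of_exponent_ge (by norm_num) (by norm_num) (Nat.floor_le h2)

lemma norm_add_sum_smul_le_of_subsets {V : Type*} [NormedAddCommGroup V] [NormedSpace ℝ V]
    {ι : Type*} [DecidableEq ι] (v : ι → V) (M : ℝ) (B : Finset ι) (a : ι → ℝ)
    (ha : ∀ j ∈ B, 0 ≤ a j ∧ a j ≤ 1) :
    ∀ w : V, (∀ A ⊆ B, ‖w + ∑ j ∈ A, v j‖ ≤ M) → ‖w + ∑ j ∈ B, a j • v j‖ ≤ M := by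
  induction B using Finset.induction_on with
  | empty => exact fun w hw => by simpa using hw ∅ subset_rfl
  | insert i B hi ih =>
    intro w hw
    rw [Finset.sum_insert hi, ← add_assoc]
    refine ih (fun j hj => ha j (Finset.mem_insert_of_mem hj)) _ fun A hA => ?_
    have hiA : i ∉ A := fun h => hi (hA h)
    have h1 := hw A (hA.trans (Finset.subset_insert _ _))
    have h2 := hw (insert i A) (Finset.insert_subset_insert _ hA)
    rw [Finset.sum_insert hiA] at h2
    obtain ⟨h3, h4⟩ := ha i (Finset.mem_insert_self _ _)
    have h5 : w + a i • v i + ∑ j ∈ A, v j =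
        (1 - a i) • (w + ∑ j ∈ A, v j) + a i • (w + (v i + ∑ j ∈ A, v j)) := by
      module
    rw [h5]
    refine (norm_add_le _ _).trans ?_
    rw [norm_smul, norm_smul, Real.norm_of_nonneg h3, Real.norm_of_nonneg (sub_nonneg.2 h4)]
    nlinarith

variable {𝕂 : Type*} [RCLike 𝕂] {Y : Type*} [NormedAddCommGroup Y] [NormedSpace 𝕂 Y]

lemma norm_sum_smul_le_of_subsets {ι : Type*} [DecidableEq ι] (v : ι → Y) {M l : ℝ} (hl : 0 < l)
    (B : Finset ι) (a : ι → 𝕂) (ha : ∀ j ∈ B, ‖a j‖ ≤ l)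
    (hB : ∀ A ⊆ B, ‖∑ j ∈ A, v j‖ ≤ M) : ‖∑ j ∈ B, a j • v j‖ ≤ 4 * (l * M) := by
  let _ : NormedSpace ℝ Y := NormedSpace.restrictScalars ℝ 𝕂 Y
  have hsmul : ∀ (r : ℝ) (y : Y), r • y = (r : 𝕂) • y := fun _ _ => rfl
  have key : ∀ g : 𝕂 → ℝ, (∀ z, g z ≤ ‖z‖) → ‖∑ j ∈ B, ((max (g (a j)) 0 : ℝ) : 𝕂) • v j‖
      ≤ l * M := by
    intro g hg
    have h1 := norm_add_sum_smul_le_of_subsets v M B (fun j => l⁻¹ * max (g (a j)) 0)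
      (fun j hj => ⟨by positivity, by
        rw [inv_mul_le_iff₀ hl, mul_one]
        exact max_le ((hg _).trans (ha j hj)) hl.le⟩) 0 (by simpa using hB)
    rw [zero_add] at h1
    simp only [mul_smul] at h1
    rw [← Finset.smul_sum, norm_smul, Real.norm_of_nonneg (by positivity), inv_mul_le_iff₀ hl] at h1
    simpa only [hsmul] using h1
  have h1 := key (fun z => RCLike.re z) (RCLike.re_le_norm)
  have h2 := key (fun z => -RCLike.re z) (fun z => by
    have := RCLike.re_le_norm (-z)
    simpa using this)
  have h3 := key (fun z => RCLike.im z) (RCLike.im_le_norm)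
  have h4 := key (fun z => -RCLike.im z) (fun z => by
    have := RCLike.im_le_norm (-z)
    simpa using this)
  have hmm : ∀ r : ℝ, max r 0 - max (-r) 0 = r := fun r => by
    rcases le_total 0 r with h | h
    · rw [max_eq_left h, max_eq_right (by linarith), sub_zero]
    · rw [max_eq_right h, max_eq_left (by linarith)]; ring
  have hdec : ∀ z : 𝕂, z = ((max (RCLike.re z) 0 : ℝ) : 𝕂) - ((max (-RCLike.re z) 0 : ℝ) : 𝕂)
      + RCLike.I * (((max (RCLike.im z) 0 : ℝ) : 𝕂) - ((max (-RCLike.im z) 0 : ℝ) : 𝕂)) := by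
    intro z
    rw [← RCLike.ofReal_sub, ← RCLike.ofReal_sub, hmm, hmm]
    conv_lhs => rw [← RCLike.re_add_im z]
    ring
  have hsum : ∑ j ∈ B, a j • v j =
      (∑ j ∈ B, ((max (RCLike.re (a j)) 0 : ℝ) : 𝕂) • v j -
        ∑ j ∈ B, ((max (-RCLike.re (a j)) 0 : ℝ) : 𝕂) • v j) +
      (RCLike.I : 𝕂) • (∑ j ∈ B, ((max (RCLike.im (a j)) 0 : ℝ) : 𝕂) • v j -
        ∑ j ∈ B, ((max (-RCLike.im (a j)) 0 : ℝ) : 𝕂) • v j) := by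
    rw [← Finset.sum_sub_distrib, ← Finset.sum_sub_distrib, Finset.smul_sum,
      ← Finset.sum_add_distrib]
    refine Finset.sum_congr rfl fun j _ => ?_
    conv_lhs => rw [hdec (a j)]
    rw [add_smul, sub_smul, mul_smul, sub_smul]
  rw [hsum]
  refine (norm_add_le _ _).trans ?_
  rw [norm_smul]
  have h5 := norm_sub_le (∑ j ∈ B, ((max (RCLike.re (a j)) 0 : ℝ) : 𝕂) • v j)
    (∑ j ∈ B, ((max (-RCLike.re (a j)) 0 : ℝ) : 𝕂) • v j)
  have h6 := norm_sub_le (∑ j ∈ B, ((max (RCLike.im (a j)) 0 : ℝ) : 𝕂) • v j)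
    (∑ j ∈ B, ((max (-RCLike.im (a j)) 0 : ℝ) : 𝕂) • v j)
  have h7 : ‖(RCLike.I : 𝕂)‖ ≤ 1 := by
    rcases RCLike.I_eq_zero_or_im_I_eq_one (K := 𝕂) with h | h
    · rw [h, norm_zero]; exact zero_le_one
    · have h0 : (RCLike.I : 𝕂) ≠ 0 := fun h0 => by simp [h0] at h
      exact (RCLike.norm_I_of_ne_zero h0).le
  have h8 := mul_le_of_le_one_left (norm_nonneg
    (∑ j ∈ B, ((max (RCLike.im (a j)) 0 : ℝ) : 𝕂) • v j -
        ∑ j ∈ B, ((max (-RCLike.im (a j)) 0 : ℝ) : 𝕂) • v j)) h7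
  linarith

/-- Upper estimates for sums over sets give upper `ℓ_t`-estimates for every smaller exponent. -/
theorem hasUpperEstimates_of_subset_sums {s t c C : ℝ} (ht : 0 < t) (hts : t < s) (hc : 0 < c)
    (h : ∀ k : ℕ, ∃ v : ℕ → Y, (∀ j < k, c ≤ ‖v j‖) ∧
      ∀ A ⊆ Finset.range k, ‖∑ j ∈ A, v j‖ ≤ C * (A.card : ℝ) ^ (1 / s)) :
    HasUpperEstimates 𝕂 Y t := by
  have hs : 0 < s := ht.trans hts
  have hC : 0 ≤ C := by
    obtain ⟨v, hv, hv'⟩ := h 1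
    have := (norm_nonneg _).trans (hv' {0} (by simp))
    simpa using this
  set ρ : ℝ := (2⁻¹ : ℝ) ^ (1 - t / s) with hρ
  have hts' : 0 < 1 - t / s := by
    rw [sub_pos, div_lt_one hs]; exact hts
  have hρ0 : 0 ≤ ρ := by positivity
  have hρ1 : ρ < 1 := Real.rpow_lt_one (by norm_num) (by norm_num) hts'
  set K : ℝ := 4 * (C * 2 ^ (t / s)) with hK
  have hK0 : 0 ≤ K := by positivity
  refine ⟨c⁻¹ * (K * (1 - ρ)⁻¹), by have := sub_pos.2 hρ1; positivity, fun N => ?_⟩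
  obtain ⟨v, hv, hv'⟩ := h N
  refine ⟨fun j => ((c⁻¹ : ℝ) : 𝕂) • v j, fun j hj => ?_, fun a ha => ?_⟩
  · rw [norm_smul, RCLike.norm_ofReal, abs_of_pos (by positivity), le_inv_mul_iff₀ hc, mul_one]
    exact hv j hj
  have hpull : ∑ j ∈ Finset.range N, a j • ((c⁻¹ : ℝ) : 𝕂) • v j =
      ((c⁻¹ : ℝ) : 𝕂) • ∑ j ∈ Finset.range N, a j • v j := by
    rw [Finset.smul_sum]
    exact Finset.sum_congr rfl fun j _ => smul_comm _ _ _
  rw [hpull, norm_smul, RCLike.norm_ofReal, abs_of_pos (by positivity)]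
  refine mul_le_mul_of_nonneg_left ?_ (by positivity)
  have ha1 : ∀ j ∈ Finset.range N, ‖a j‖ ≤ 1 := by
    intro j hj
    have h1 := (Finset.single_le_sum (f := fun j => ‖a j‖ ^ t) (fun _ _ => by positivity) hj).trans
      ha
    by_contra hcon
    exact absurd h1 (not_le.2 (Real.one_lt_rpow (not_le.1 hcon) ht))
  have hlev : ∀ j, ∃ l : ℕ, j ∈ Finset.range N → a j ≠ 0 →
      (2⁻¹ : ℝ) ^ (l + 1) ≤ ‖a j‖ ∧ ‖a j‖ ≤ (2⁻¹ : ℝ) ^ l := by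
    intro j
    by_cases hj : j ∈ Finset.range N ∧ a j ≠ 0
    · obtain ⟨l, hl⟩ := exists_dyadic_level (norm_pos_iff.2 hj.2) (ha1 j hj.1)
      exact ⟨l, fun _ _ => hl⟩
    · exact ⟨0, fun h1 h2 => absurd ⟨h1, h2⟩ hj⟩
  choose lev hlev using hlev
  let S : Finset ℕ := (Finset.range N).filter fun j => a j ≠ 0
  have hS : ∑ j ∈ Finset.range N, a j • v j = ∑ j ∈ S, a j • v j := by
    rw [Finset.sum_filter_of_ne]
    intro j _ hj h0
    exact hj (by rw [h0, zero_smul])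
  rw [hS, ← Finset.sum_fiberwise_of_maps_to (t := S.image lev) (g := lev)
    (fun j hj => Finset.mem_image_of_mem _ hj)]
  have hblock : ∀ i, ‖∑ j ∈ S with lev j = i, a j • v j‖ ≤ K * ρ ^ i := by
    intro i
    set B : Finset ℕ := S.filter fun j => lev j = i with hBdef
    have hBN : B ⊆ Finset.range N := (Finset.filter_subset _ _).trans (Finset.filter_subset _ _)
    have hB : ∀ j ∈ B, (2⁻¹ : ℝ) ^ (i + 1) ≤ ‖a j‖ ∧ ‖a j‖ ≤ (2⁻¹ : ℝ) ^ i := by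
      intro j hj
      have h1 := (Finset.mem_filter.1 hj).2
      have h2 := hlev j (hBN hj) (Finset.mem_filter.1 (Finset.mem_filter.1 hj).1).2
      rwa [h1] at h2
    have hcard : (B.card : ℝ) ≤ ((2 : ℝ) ^ (i + 1)) ^ t := by
      have h1 : (B.card : ℝ) * ((2⁻¹ : ℝ) ^ (i + 1)) ^ t ≤ 1 := by
        calc (B.card : ℝ) * ((2⁻¹ : ℝ) ^ (i + 1)) ^ t = ∑ j ∈ B, ((2⁻¹ : ℝ) ^ (i + 1)) ^ t := by
              rw [Finset.sum_const, nsmul_eq_mul]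
          _ ≤ ∑ j ∈ B, ‖a j‖ ^ t := Finset.sum_le_sum fun j hj =>
              Real.rpow_le_rpow (by positivity) (hB j hj).1 ht.le
          _ ≤ ∑ j ∈ Finset.range N, ‖a j‖ ^ t :=
              Finset.sum_le_sum_of_subset_of_nonneg hBN fun _ _ _ => by positivity
          _ ≤ 1 := ha
      rw [inv_pow, Real.inv_rpow (by positivity), mul_inv_le_iff₀ (by positivity), one_mul] at h1
      exact h1
    have h1 := norm_sum_smul_le_of_subsets v (M := C * (B.card : ℝ) ^ (1 / s))
      (l := (2⁻¹ : ℝ) ^ i) (by positivity) B a (fun j hj => (hB j hj).2) (fun A hA => by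
        refine (hv' A (hA.trans hBN)).trans (mul_le_mul_of_nonneg_left ?_ hC)
        refine Real.rpow_le_rpow (by positivity) ?_ (by positivity)
        exact_mod_cast Finset.card_le_card hA)
    refine h1.trans ?_
    have h2 : (B.card : ℝ) ^ (1 / s) ≤ 2 ^ (t / s) * (2 ^ (t / s)) ^ i := by
      refine (Real.rpow_le_rpow (by positivity) hcard (by positivity)).trans_eq ?_
      rw [← pow_succ', ← Real.rpow_natCast (2 ^ (t / s)), ← Real.rpow_natCast 2, ← Real.rpow_mul (by positivity),
        ← Real.rpow_mul (by positivity), ← Real.rpow_mul (by positivity)]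
      congr 1
      field_simp
    have h3 : ρ = 2⁻¹ * 2 ^ (t / s) := by
      rw [hρ, Real.rpow_sub (by norm_num), Real.rpow_one, Real.inv_rpow (by norm_num), div_inv_eq_mul]
    calc 4 * ((2⁻¹ : ℝ) ^ i * (C * (B.card : ℝ) ^ (1 / s)))
        ≤ 4 * ((2⁻¹ : ℝ) ^ i * (C * (2 ^ (t / s) * (2 ^ (t / s)) ^ i))) := by gcongr
      _ = K * ρ ^ i := by rw [h3, hK, mul_pow]; ring
  refine (norm_sum_le _ _).trans ((Finset.sum_le_sum fun i _ => hblock i).trans ?_)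
  rw [← Finset.mul_sum]
  refine mul_le_mul_of_nonneg_left ?_ hK0
  rw [← tsum_geometric_of_lt_one hρ0 hρ1]
  exact (summable_geometric_of_lt_one hρ0 hρ1).sum_le_tsum _ fun _ _ => by positivity

end WeakToStrong

section Signs

/-- The sign `±1` encoded by a Boolean. -/
def boolSign (b : Bool) : ℝ := if b then 1 else -1

lemma boolSign_xor (a b : Bool) : boolSign (xor a b) = -(boolSign a * boolSign b) := by
  cases a <;> cases b <;> simp [boolSign]

lemma abs_boolSign (b : Bool) : |boolSign b| = 1 := by
  cases b <;> simp [boolSign]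

lemma boolSign_smul {Y : Type*} [AddCommGroup Y] [Module ℝ Y] (b : Bool) (y : Y) :
    boolSign b • y = if b then y else -y := by
  cases b <;> simp [boolSign]

/-- The average of a function of independent random signs. -/
noncomputable def signAvg {ι : Type*} [Fintype ι] [DecidableEq ι] (F : (ι → Bool) → ℝ) : ℝ :=
  (2 ^ Fintype.card ι : ℝ)⁻¹ * ∑ ε, F ε

variable {ι κ : Type*} [Fintype ι] [DecidableEq ι] [Fintype κ] [DecidableEq κ]

lemma signAvg_mono {F G : (ι → Bool) → ℝ} (h : ∀ ε, F ε ≤ G ε) : signAvg F ≤ signAvg G :=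
  mul_le_mul_of_nonneg_left (Finset.sum_le_sum fun ε _ => h ε) (by positivity)

lemma signAvg_const (c : ℝ) : signAvg (fun _ : ι → Bool => c) = c := by
  simp [signAvg]

lemma signAvg_add (F G : (ι → Bool) → ℝ) :
    signAvg (fun ε => F ε + G ε) = signAvg F + signAvg G := by
  simp only [signAvg, Finset.sum_add_distrib, mul_add]

lemma signAvg_const_mul (c : ℝ) (F : (ι → Bool) → ℝ) :
    signAvg (fun ε => c * F ε) = c * signAvg F := by
  simp only [signAvg, ← Finset.mul_sum]
  ring

lemma signAvg_comm (F : (ι → Bool) → (κ → Bool) → ℝ) :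
    signAvg (fun ε => signAvg (F ε)) = signAvg fun δ => signAvg fun ε => F ε δ := by
  simp only [signAvg, ← Finset.mul_sum]
  rw [Finset.sum_comm]
  ring

lemma signAvg_nonneg {F : (ι → Bool) → ℝ} (h : ∀ ε, 0 ≤ F ε) : 0 ≤ signAvg F :=
  mul_nonneg (by positivity) (Finset.sum_nonneg fun ε _ => h ε)

lemma exists_le_of_signAvg_le {F : (ι → Bool) → ℝ} {c : ℝ} (h : signAvg F ≤ c) : ∃ ε, F ε ≤ c := by
  by_contra! hcon
  have h1 : (2 ^ Fintype.card ι : ℝ) * c < ∑ ε, F ε := by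
    calc (2 ^ Fintype.card ι : ℝ) * c = ∑ _ε : ι → Bool, c := by simp
      _ < ∑ ε, F ε := Finset.sum_lt_sum_of_nonempty Finset.univ_nonempty fun ε _ => hcon ε
  rw [signAvg, inv_mul_le_iff₀ (by positivity)] at h
  linarith

lemma signAvg_xor (η : ι → Bool) (F : (ι → Bool) → ℝ) :
    signAvg (fun ε => F fun j => xor (ε j) (η j)) = signAvg F := by
  have hinv : Function.Involutive fun (ε : ι → Bool) j => xor (ε j) (η j) := fun ε => by
    funext j
    simp
  unfold signAvg
  congr 1
  exact Equiv.sum_comp hinv.toPerm F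

lemma signAvg_comp {g : ι → κ} (hg : Function.Injective g) (F : (ι → Bool) → ℝ) :
    signAvg (fun ε : κ → Bool => F (ε ∘ g)) = signAvg F := by
  have h1 := signAvg_comm fun (ε : κ → Bool) (δ : ι → Bool) => F fun j => xor (δ j) ((ε ∘ g) j)
  simp only [fun ε : κ → Bool => signAvg_xor (ε ∘ g) F, signAvg_const] at h1
  rw [h1]
  have h2 : ∀ δ : ι → Bool, signAvg (fun ε : κ → Bool => F fun j => xor (δ j) ((ε ∘ g) j)) =
      signAvg fun ε : κ → Bool => F (ε ∘ g) := by
    intro δ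
    rw [← signAvg_xor (Function.extend g δ fun _ => false) fun ε : κ → Bool => F (ε ∘ g)]
    refine congrArg signAvg (funext fun ε => congrArg F (funext fun j => ?_))
    simp only [Function.comp_apply, hg.extend_apply]
    exact Bool.xor_comm _ _
  simp only [h2, signAvg_const]

lemma signAvg_sum_sq : signAvg (fun ε : ι → Bool => (∑ j, boolSign (ε j)) ^ 2) =
    Fintype.card ι := by
  have h1 : ∀ i j : ι, signAvg (fun ε : ι → Bool => boolSign (ε i) * boolSign (ε j)) =
      if i = j then 1 else 0 := by
    intro i j
    split_ifs with h
    · subst h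
      have : ∀ b, boolSign b * boolSign b = 1 := fun b => by cases b <;> simp [boolSign]
      simp only [this, signAvg_const]
    · have h2 := signAvg_xor (fun k => decide (k = i))
        fun ε : ι → Bool => boolSign (ε i) * boolSign (ε j)
      have h3 : ∀ b, boolSign (!b) = -boolSign b := fun b => by cases b <;> simp [boolSign]
      simp only [decide_true, Bool.xor_true, Ne.symm h, decide_false, Bool.xor_false, h3] at h2
      have h4 := signAvg_const_mul (-1) fun ε : ι → Bool => boolSign (ε i) * boolSign (ε j)
      simp only [neg_mul, one_mul] at h2 h4
      linarith
  have h2 : ∀ ε : ι → Bool, (∑ j, boolSign (ε j)) ^ 2 =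
      ∑ i, ∑ j, boolSign (ε i) * boolSign (ε j) := fun ε => by
    rw [sq, Finset.sum_mul_sum]
  have h3 : ∀ (s : Finset ι) (F : ι → (ι → Bool) → ℝ),
      signAvg (fun ε => ∑ i ∈ s, F i ε) = ∑ i ∈ s, signAvg (F i) := by
    intro s F
    simp only [signAvg, ← Finset.mul_sum]
    rw [Finset.sum_comm]
  simp only [h2, h3, h1]
  simp

variable {Y : Type*} [SeminormedAddCommGroup Y] [NormedSpace ℝ Y]

/-- The second moment of the Rademacher sum of the family `y`. -/
noncomputable def radSq (y : ι → Y) : ℝ :=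
  signAvg fun ε : ι → Bool => ‖∑ j, boolSign (ε j) • y j‖ ^ 2

lemma radSq_nonneg (y : ι → Y) : 0 ≤ radSq y := signAvg_nonneg fun _ => by positivity

lemma radSq_smul (c : ℝ) (y : ι → Y) : radSq (fun j => c • y j) = c ^ 2 * radSq y := by
  rw [radSq, radSq, ← signAvg_const_mul]
  refine congrArg signAvg (funext fun ε => ?_)
  simp only [smul_comm _ c]
  rw [← Finset.smul_sum, norm_smul, mul_pow, Real.norm_eq_abs, sq_abs]

lemma norm_sq_le_radSq (y : ι → Y) (i : ι) : ‖y i‖ ^ 2 ≤ radSq y := by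
  let S : (ι → Bool) → Y := fun ε => ∑ j, boolSign (ε j) • y j
  have h1 := signAvg_xor (fun k => !decide (k = i)) fun ε : ι → Bool => ‖S ε‖ ^ 2
  have h2 : ∀ ε : ι → Bool, ‖y i‖ ^ 2 ≤
      2⁻¹ * (‖S ε‖ ^ 2 + ‖S fun k => xor (ε k) (!decide (k = i))‖ ^ 2) := by
    intro ε
    have h3 : S ε + S (fun k => xor (ε k) (!decide (k = i))) = (2 * boolSign (ε i)) • y i := by
      simp only [S]
      rw [← Finset.sum_add_distrib, Finset.sum_eq_single i]
      · simp only [decide_true, Bool.not_true, Bool.xor_false, ← add_smul]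
        ring_nf
      · intro j _ hj
        simp only [hj, decide_false, Bool.not_false, Bool.xor_true, ← add_smul]
        cases ε j <;> simp [boolSign]
      · simp
    have h4 : 2 * ‖y i‖ ≤ ‖S ε‖ + ‖S fun k => xor (ε k) (!decide (k = i))‖ := by
      have := norm_add_le (S ε) (S fun k => xor (ε k) (!decide (k = i)))
      rwa [h3, norm_smul, Real.norm_eq_abs, abs_mul, abs_boolSign, abs_two, mul_one] at this
    nlinarith [norm_nonneg (y i), sq_nonneg (‖S ε‖ - ‖S fun k => xor (ε k) (!decide (k = i))‖)]
  have h3 := signAvg_mono h2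
  rw [signAvg_const, signAvg_const_mul, signAvg_add, h1] at h3
  change _ ≤ signAvg fun ε : ι → Bool => ‖S ε‖ ^ 2
  linarith

/-- Grouping the terms of a Rademacher sum into blocks with independent signs. -/
lemma signAvg_radSq_blocks (y : ι → Y) (c : ι → κ) :
    signAvg (fun ε : ι → Bool => radSq fun i : κ => ∑ j with c j = i, boolSign (ε j) • y j) =
      radSq y := by
  simp only [radSq]
  rw [signAvg_comm]
  have h1 : ∀ δ : κ → Bool, signAvg (fun ε : ι → Bool =>
      ‖∑ i, boolSign (δ i) • ∑ j with c j = i, boolSign (ε j) • y j‖ ^ 2) = radSq y := by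
    intro δ
    rw [radSq, ← signAvg_xor (fun j => δ (c j)) fun ε => ‖∑ j, boolSign (ε j) • y j‖ ^ 2]
    refine congrArg signAvg (funext fun ε => ?_)
    congr 1
    rw [← norm_neg, ← Finset.sum_fiberwise_of_maps_to (t := Finset.univ) (g := c)
      (f := fun j => boolSign (xor (ε j) (δ (c j))) • y j) (fun _ _ => Finset.mem_univ _),
      ← Finset.sum_neg_distrib]
    congr 1
    refine Finset.sum_congr rfl fun i _ => ?_
    rw [Finset.smul_sum, ← Finset.sum_neg_distrib]
    refine Finset.sum_congr rfl fun j hj => ?_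
    rw [boolSign_xor, (Finset.mem_filter.1 hj).2, smul_smul, neg_smul, mul_comm]
  simp only [h1, signAvg_const]
  rfl

omit [DecidableEq κ] in
/-- The triangle inequality in `ℓ_p` for averages of nonnegative functions. -/
lemma sum_signAvg_rpow_le {p : ℝ} (hp : 1 ≤ p) (a : κ → (ι → Bool) → ℝ) (ha : ∀ i ε, 0 ≤ a i ε) :
    (∑ i, signAvg (a i) ^ p) ^ (1 / p) ≤ signAvg fun ε => (∑ i, a i ε ^ p) ^ (1 / p) := by
  let Nm : (κ → ℝ) → ℝ := fun f => (∑ i, |f i| ^ p) ^ (1 / p)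
  have hp0 : 0 < p := zero_lt_one.trans_le hp
  have hNm0 : Nm 0 = 0 := by
    simp [Nm, Real.zero_rpow hp0.ne', Real.zero_rpow (inv_ne_zero hp0.ne')]
  have h1 : Nm (∑ ε, fun i => a i ε) ≤ ∑ ε : ι → Bool, Nm fun i => a i ε :=
    Finset.le_sum_of_subadditive Nm hNm0.le (fun f g => Real.Lp_add_le _ _ _ hp) _ _
  have h2 : ∀ i, 0 ≤ ∑ ε, a i ε := fun i => Finset.sum_nonneg fun ε _ => ha i ε
  simp only [Nm, Finset.sum_apply, abs_of_nonneg (h2 _), abs_of_nonneg (ha _ _)] at h1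
  simp only [signAvg]
  refine le_trans (le_of_eq ?_) (mul_le_mul_of_nonneg_left h1 (by positivity))
  have h3 : ∀ i, ((2 ^ Fintype.card ι : ℝ)⁻¹ * ∑ ε, a i ε) ^ p =
      ((2 ^ Fintype.card ι : ℝ)⁻¹) ^ p * (∑ ε, a i ε) ^ p := fun i =>
    Real.mul_rpow (by positivity) (h2 i)
  simp only [h3]
  rw [← Finset.mul_sum, Real.mul_rpow (by positivity)
    (Finset.sum_nonneg fun i _ => Real.rpow_nonneg (h2 i) _), ← Real.rpow_mul (by positivity),
    mul_one_div_cancel hp0.ne', Real.rpow_one]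

end Signs

section Exhaustion

variable {ι κ : Type*} [Fintype ι] [DecidableEq ι] [Fintype κ] [DecidableEq κ]

/-- A maximal disjoint family of bad blocks, encoded by a map `c` whose fibres are the blocks. -/
lemma exists_maximal_blocks (bad : Finset ι → Prop) (hbad : ¬bad ∅) :
    ∃ (G : Finset ι) (c : ι → ι), (∀ j ∈ G, c j ∈ G) ∧ (∀ j ∉ G, c j = j) ∧
      (∀ i ∈ G, (Finset.univ.filter fun j => c j = i) = ∅ ∨
        bad (Finset.univ.filter fun j => c j = i)) ∧
      ∀ B, Disjoint B G → ¬bad B := by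
  classical
  let Q : Finset ι → Prop := fun G => ∃ c : ι → ι, (∀ j ∈ G, c j ∈ G) ∧ (∀ j ∉ G, c j = j) ∧
      (∀ i ∈ G, (Finset.univ.filter fun j => c j = i) = ∅ ∨
        bad (Finset.univ.filter fun j => c j = i))
  have hQ : Q ∅ := ⟨id, by simp, by simp, by simp⟩
  obtain ⟨G, hG, hmax⟩ := Finset.exists_max_image (Finset.univ.filter Q) Finset.card
    ⟨∅, by simpa using hQ⟩
  obtain ⟨c, h1, h2, h3⟩ := (Finset.mem_filter.1 hG).2
  refine ⟨G, c, h1, h2, h3, fun B hB hbB => ?_⟩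
  have hBne : B.Nonempty := by
    rw [Finset.nonempty_iff_ne_empty]
    rintro rfl
    exact hbad hbB
  obtain ⟨i₀, hi₀⟩ := hBne
  have hBG : ∀ j ∈ B, j ∉ G := fun j hj => Finset.disjoint_left.1 hB hj
  have hcB : ∀ j, j ∉ B → c j ∉ B := by
    intro j hj hcj
    by_cases hjG : j ∈ G
    · exact hBG _ hcj (h1 j hjG)
    · rw [h2 j hjG] at hcj; exact hj hcj
  have hnew : Q (G ∪ B) := by
    refine ⟨fun j => if j ∈ B then i₀ else c j, fun j hj => ?_, fun j hj => ?_, fun i hi => ?_⟩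
    · by_cases hjB : j ∈ B
      · simp [hjB, hi₀]
      · have : j ∈ G := by simpa [hjB] using hj
        simp [hjB, h1 j this]
    · rw [Finset.mem_union, not_or] at hj
      simp [hj.2, h2 j hj.1]
    · by_cases hiB : i ∈ B
      · by_cases hi0 : i = i₀
        · right
          subst hi0
          convert hbB
          ext j
          by_cases hjB : j ∈ B
          · simp [hjB]
          · have : c j ≠ i := fun h => hcB j hjB (h ▸ hiB)
            simp [hjB, this]
        · left
          ext j
          by_cases hjB : j ∈ B
          · simp [hjB, Ne.symm hi0]
          · have : c j ≠ i := fun h => hcB j hjB (h ▸ hiB)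
            simp [hjB, this]
      · have hiG : i ∈ G := by simpa [hiB] using hi
        have : (Finset.univ.filter fun j => (if j ∈ B then i₀ else c j) = i) =
            Finset.univ.filter fun j => c j = i := by
          ext j
          by_cases hjB : j ∈ B
          · have h4 : i₀ ≠ i := fun h => hiB (h ▸ hi₀)
            have h5 : c j ≠ i := fun h => hBG j hjB (by
              have h6 := h2 j (hBG j hjB)
              rw [← h6, h]; exact hiG)
            simp [hjB, h4, h5]
          · simp [hjB]
        rw [this]
        exact h3 i hiG
  have h4 := hmax _ (Finset.mem_filter.2 ⟨Finset.mem_univ _, hnew⟩)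
  rw [Finset.card_union_of_disjoint hB.symm] at h4
  have := Finset.card_pos.2 ⟨i₀, hi₀⟩
  omega

variable {Y : Type*} [NormedAddCommGroup Y] [NormedSpace ℝ Y]

/-- The second moment of the part of a Rademacher sum with indices in `B`. -/
noncomputable def radSqOn (B : Finset ι) (y : ι → Y) : ℝ :=
  signAvg fun ε : ι → Bool => ‖∑ j ∈ B, boolSign (ε j) • y j‖ ^ 2

omit [DecidableEq κ] in
lemma radSqOn_nonneg (B : Finset ι) (y : ι → Y) : 0 ≤ radSqOn B y :=
  signAvg_nonneg fun _ => by positivity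

lemma radSqOn_map {g : κ → ι} (hg : Function.Injective g) (y : ι → Y) :
    radSqOn (Finset.univ.map ⟨g, hg⟩) y = radSq fun k => y (g k) := by
  unfold radSqOn radSq
  rw [← signAvg_comp hg]
  simp

lemma sum_radSqOn_rpow_le {s K : ℝ} (hs : 2 ≤ s) (hK0 : 0 ≤ K)
    (hK : ∀ z : κ → Y, ∑ i, ‖z i‖ ^ s ≤ K * radSq z ^ (s / 2)) (y : ι → Y) (c : ι → κ) :
    ∑ i, radSqOn (Finset.univ.filter fun j => c j = i) y ^ (s / 2) ≤ K * radSq y ^ (s / 2) := by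
  have hp : 1 ≤ s / 2 := by linarith
  have hp0 : 0 < s / 2 := by linarith
  let z : (ι → Bool) → κ → Y := fun ε i => ∑ j with c j = i, boolSign (ε j) • y j
  have h1 := sum_signAvg_rpow_le hp (fun (i : κ) (ε : ι → Bool) => ‖z ε i‖ ^ 2)
    fun _ _ => by positivity
  have h2 : ∀ ε, (∑ i, (‖z ε i‖ ^ 2) ^ (s / 2)) ^ (1 / (s / 2)) ≤
      K ^ (1 / (s / 2)) * radSq (z ε) := by
    intro ε
    have h3 : ∀ i, (‖z ε i‖ ^ 2) ^ (s / 2) = ‖z ε i‖ ^ s := fun i => by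
      rw [← Real.rpow_natCast, ← Real.rpow_mul (norm_nonneg _)]
      congr 1
      push_cast
      ring
    simp only [h3]
    refine (Real.rpow_le_rpow (Finset.sum_nonneg fun _ _ => by positivity) (hK _)
      (by positivity)).trans_eq ?_
    rw [Real.mul_rpow hK0 (Real.rpow_nonneg (radSq_nonneg _) _), ← Real.rpow_mul (radSq_nonneg _),
      mul_one_div_cancel hp0.ne', Real.rpow_one]
  have h3 := h1.trans (signAvg_mono h2)
  rw [signAvg_const_mul, signAvg_radSq_blocks] at h3
  have h4 := Real.rpow_le_rpow (Real.rpow_nonneg (Finset.sum_nonneg fun i _ =>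
    Real.rpow_nonneg (signAvg_nonneg fun _ => by positivity) _) _) h3 hp0.le
  rw [← Real.rpow_mul (Finset.sum_nonneg fun i _ =>
    Real.rpow_nonneg (signAvg_nonneg fun _ => by positivity) _), one_div_mul_cancel hp0.ne',
    Real.rpow_one, Real.mul_rpow (by positivity) (radSq_nonneg _), ← Real.rpow_mul hK0,
    one_div_mul_cancel hp0.ne', Real.rpow_one] at h4
  exact h4

/-- If cotype `s` fails there are families for which cotype `s` is reversed, up to a constant, on
all subsets of a large set of indices. -/
lemma exists_reverse_cotype {s : ℝ} (hs : 2 ≤ s) (h : ¬HasCotype Y s) {R : ℝ} (hR : 0 < R) :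
    ∃ (n : ℕ) (y : Fin n → Y) (G : Finset (Fin n)), (∀ j, ‖y j‖ ≤ 1) ∧
      R ≤ ∑ j ∈ G, ‖y j‖ ^ s ∧
      ∀ B ⊆ G, radSqOn B y ^ (s / 2) ≤ 4 * ∑ j ∈ B, ‖y j‖ ^ s := by
  have hs0 : 0 < s := by linarith
  unfold HasCotype at h
  push Not at h
  obtain ⟨n, x, hx⟩ := h ((4 * R) ^ (1 / s)) (by positivity)
  have hxr : (2 ^ n : ℝ)⁻¹ * ∑ ε : Fin n → Bool, ‖∑ j, (if ε j then x j else -x j)‖ ^ 2 =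
      radSq x := by
    simp [radSq, signAvg, boolSign_smul]
  rw [hxr] at hx
  let S : Set ℝ := {r | ∃ y : Fin n → Y, radSq y ≤ 1 ∧ r = ∑ j, ‖y j‖ ^ s}
  have hle1 : ∀ y : Fin n → Y, radSq y ≤ 1 → ∀ j, ‖y j‖ ≤ 1 := fun y hy j => by
    have := (norm_sq_le_radSq y j).trans hy
    have := norm_nonneg (y j)
    nlinarith
  have hSb : BddAbove S := by
    refine ⟨n, ?_⟩
    rintro r ⟨y, hy, rfl⟩
    calc ∑ j, ‖y j‖ ^ s ≤ ∑ _j : Fin n, (1 : ℝ) := Finset.sum_le_sum fun j _ =>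
          Real.rpow_le_one (norm_nonneg _) (hle1 y hy j) hs0.le
      _ = n := by simp
  set K := sSup S with hKdef
  have hS0 : (0 : ℝ) ∈ S := ⟨0, by simp [radSq, signAvg_const], by simp [Real.zero_rpow hs0.ne']⟩
  have hK0 : 0 ≤ K := le_csSup hSb hS0
  have hK : ∀ z : Fin n → Y, ∑ i, ‖z i‖ ^ s ≤ K * radSq z ^ (s / 2) := by
    intro z
    rcases (radSq_nonneg z).eq_or_lt with h0 | h0
    · have hz : ∀ i, ‖z i‖ = 0 := fun i => by
        have := norm_sq_le_radSq z i
        rw [← h0] at this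
        exact pow_eq_zero_iff two_ne_zero |>.1 (le_antisymm this (by positivity))
      simp only [hz, Real.zero_rpow hs0.ne', Finset.sum_const_zero]
      exact mul_nonneg hK0 (Real.rpow_nonneg (radSq_nonneg _) _)
    · set b : ℝ := (Real.sqrt (radSq z))⁻¹ with hb
      have hb0 : 0 < b := by positivity
      have hmem : ∑ j, ‖b • z j‖ ^ s ∈ S := ⟨fun j => b • z j, by
        rw [radSq_smul, hb, inv_pow, Real.sq_sqrt h0.le, inv_mul_cancel₀ h0.ne'], rfl⟩
      have h1 := le_csSup hSb hmem
      have h2 : ∀ j, ‖b • z j‖ ^ s = (radSq z ^ (s / 2))⁻¹ * ‖z j‖ ^ s := fun j => by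
        rw [norm_smul, Real.mul_rpow (norm_nonneg _) (norm_nonneg _), Real.norm_of_nonneg hb0.le,
          hb, Real.inv_rpow (Real.sqrt_nonneg _), Real.sqrt_eq_rpow, ← Real.rpow_mul h0.le,
          one_div_mul_eq_div]
      simp only [h2] at h1
      rw [← Finset.mul_sum, inv_mul_le_iff₀ (by positivity)] at h1
      linarith
  have hKR : 4 * R < K := by
    have h1 := Real.rpow_lt_rpow (by positivity) hx hs0
    rw [Real.mul_rpow (by positivity) (Real.sqrt_nonneg _), ← Real.rpow_mul (by positivity),
      one_div_mul_cancel hs0.ne', Real.rpow_one, ← Real.rpow_mul (Finset.sum_nonneg fun _ _ =>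
      by positivity), one_div_mul_cancel hs0.ne', Real.rpow_one, Real.sqrt_eq_rpow,
      ← Real.rpow_mul (radSq_nonneg _), one_div_mul_eq_div] at h1
    exact lt_of_mul_lt_mul_right (h1.trans_le (hK x)) (Real.rpow_nonneg (radSq_nonneg _) _)
  obtain ⟨_, ⟨y, hy, rfl⟩, hyK⟩ := exists_lt_of_lt_csSup ⟨0, hS0⟩
    (show K / 2 < sSup S by rw [← hKdef]; linarith)
  obtain ⟨G, c, hc1, -, hc3, hc4⟩ := exists_maximal_blocks
    (fun B => 4 * ∑ j ∈ B, ‖y j‖ ^ s < radSqOn B y ^ (s / 2)) (by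
      have : (0 : ℝ) ^ (s / 2) = 0 := Real.zero_rpow (by positivity)
      simp [radSqOn, signAvg_const, this])
  refine ⟨n, y, Gᶜ, hle1 y hy, ?_, fun B hB => not_lt.1 (hc4 B ?_)⟩
  · have h1 : 4 * ∑ j ∈ G, ‖y j‖ ^ s ≤ K := by
      rw [← Finset.sum_fiberwise_of_maps_to (t := G) (g := c) hc1, Finset.mul_sum]
      have h2 : ∀ i ∈ G, 4 * ∑ j ∈ G with c j = i, ‖y j‖ ^ s ≤
          radSqOn (Finset.univ.filter fun j => c j = i) y ^ (s / 2) := by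
        intro i hi
        have h3 : (G.filter fun j => c j = i) ⊆ Finset.univ.filter fun j => c j = i :=
          Finset.filter_subset_filter _ (Finset.subset_univ _)
        have h4 : ∑ j ∈ G with c j = i, ‖y j‖ ^ s ≤
            ∑ j ∈ Finset.univ.filter fun j => c j = i, ‖y j‖ ^ s :=
          Finset.sum_le_sum_of_subset_of_nonneg h3 fun _ _ _ => by positivity
        rcases hc3 i hi with h5 | h5
        · rw [h5, Finset.sum_empty] at h4
          have := Real.rpow_nonneg (radSqOn_nonneg (Finset.univ.filter fun j => c j = i) y) (s / 2)
          linarith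
        · linarith
      refine (Finset.sum_le_sum h2).trans ?_
      refine (Finset.sum_le_sum_of_subset_of_nonneg (Finset.subset_univ G) fun i _ _ =>
        Real.rpow_nonneg (radSqOn_nonneg _ y) _).trans ?_
      refine (sum_radSqOn_rpow_le hs hK0 hK y c).trans (mul_le_of_le_one_right hK0 ?_)
      exact Real.rpow_le_one (radSq_nonneg _) hy (by positivity)
    have h2 := Finset.sum_add_sum_compl G fun j => ‖y j‖ ^ s
    linarith
  · exact Finset.disjoint_left.2 fun j hj => Finset.mem_compl.1 (hB hj)

end Exhaustion

section Pigeonhole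

variable {Y : Type*} [NormedAddCommGroup Y] [NormedSpace ℝ Y]

/-- If cotype `s` fails there are arbitrarily long families of vectors of norm about `1` whose
Rademacher sums satisfy an upper `s`-estimate. -/
lemma exists_radSq_le {s : ℝ} (hs : 2 ≤ s) (h : ¬HasCotype Y s) (N : ℕ) :
    ∃ y : ℕ → Y, (∀ i < N, 1 / 2 ≤ ‖y i‖ ∧ ‖y i‖ ≤ 1) ∧
      ∀ (ι : Type) [Fintype ι] [DecidableEq ι] (f : ι → ℕ), Function.Injective f →
        (∀ k, f k < N) → radSq (fun k => y (f k)) ≤ (4 * Fintype.card ι : ℝ) ^ (2 / s) := by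
  classical
  have hs0 : 0 < s := by linarith
  obtain ⟨n, x, G, hx1, hG, hB⟩ := exists_reverse_cotype hs h (R := 2 * N + 1) (by positivity)
  have hlev : ∀ j, ∃ l : ℕ, x j ≠ 0 → (2⁻¹ : ℝ) ^ (l + 1) ≤ ‖x j‖ ∧ ‖x j‖ ≤ (2⁻¹ : ℝ) ^ l := by
    intro j
    by_cases hj : x j = 0
    · exact ⟨0, fun h => absurd hj h⟩
    · obtain ⟨l, hl⟩ := exists_dyadic_level (norm_pos_iff.2 hj) (hx1 j)
      exact ⟨l, fun _ => hl⟩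
  choose lev hlev using hlev
  let S := G.filter fun j => x j ≠ 0
  have hpow : ∀ (l : ℕ) {a : ℝ}, 0 ≤ a → a ≤ (2⁻¹ : ℝ) ^ l → a ^ s ≤ (4⁻¹ : ℝ) ^ l := by
    intro l a ha hal
    calc a ^ s ≤ ((2⁻¹ : ℝ) ^ l) ^ s := Real.rpow_le_rpow ha hal hs0.le
      _ ≤ ((2⁻¹ : ℝ) ^ l) ^ (2 : ℝ) := Real.rpow_le_rpow_of_exponent_ge (by positivity)
          (pow_le_one₀ (by norm_num) (by norm_num)) hs
      _ = (4⁻¹ : ℝ) ^ l := by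
          rw [Real.rpow_two, ← pow_mul, mul_comm, pow_mul]
          norm_num
  obtain ⟨i, hi⟩ : ∃ i, N ≤ (S.filter fun j => lev j = i).card := by
    by_contra! hcon
    have h1 : ∑ j ∈ G, ‖x j‖ ^ s = ∑ j ∈ S, ‖x j‖ ^ s := by
      rw [Finset.sum_filter_of_ne]
      intro j _ hj h0
      exact hj (by rw [h0, norm_zero, Real.zero_rpow hs0.ne'])
    have h2 : ∀ i, ∑ j ∈ S with lev j = i, ‖x j‖ ^ s ≤ N * (4⁻¹ : ℝ) ^ i := by
      intro i
      calc ∑ j ∈ S with lev j = i, ‖x j‖ ^ s ≤ ∑ j ∈ S with lev j = i, (4⁻¹ : ℝ) ^ i := by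
            refine Finset.sum_le_sum fun j hj => hpow i (norm_nonneg _) ?_
            obtain ⟨hj1, hj2⟩ := Finset.mem_filter.1 hj
            rw [← hj2]
            exact (hlev j (Finset.mem_filter.1 hj1).2).2
        _ = (S.filter fun j => lev j = i).card * (4⁻¹ : ℝ) ^ i := by
            rw [Finset.sum_const, nsmul_eq_mul]
        _ ≤ N * (4⁻¹ : ℝ) ^ i := by
            have := (hcon i).le
            gcongr
    rw [h1, ← Finset.sum_fiberwise_of_maps_to (t := S.image lev) (g := lev)
      (fun j hj => Finset.mem_image_of_mem _ hj)] at hG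
    have h3 := Finset.sum_le_sum fun i (_ : i ∈ S.image lev) => h2 i
    rw [← Finset.mul_sum] at h3
    have h4 : ∑ i ∈ S.image lev, (4⁻¹ : ℝ) ^ i ≤ 2 := by
      refine ((summable_geometric_of_lt_one (r := (4⁻¹ : ℝ)) (by norm_num)
        (by norm_num)).sum_le_tsum _ fun _ _ => by positivity).trans ?_
      rw [tsum_geometric_of_lt_one (by norm_num) (by norm_num)]
      norm_num
    nlinarith [(Nat.cast_nonneg N : (0 : ℝ) ≤ N)]
  obtain ⟨g, hg⟩ : ∃ g : Fin N ↪ Fin n, ∀ k, g k ∈ S.filter fun j => lev j = i := by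
    obtain ⟨T, hT, hTc⟩ := Finset.exists_subset_card_eq hi
    exact ⟨(T.orderEmbOfFin hTc).toEmbedding, fun k => hT (T.orderEmbOfFin_mem hTc k)⟩
  have hgb : ∀ k, g k ∈ G ∧ (2⁻¹ : ℝ) ^ (i + 1) ≤ ‖x (g k)‖ ∧ ‖x (g k)‖ ≤ (2⁻¹ : ℝ) ^ i := by
    intro k
    obtain ⟨h1, h2⟩ := Finset.mem_filter.1 (hg k)
    obtain ⟨h3, h4⟩ := Finset.mem_filter.1 h1
    have := hlev _ h4
    rw [h2] at this
    exact ⟨h3, this⟩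
  refine ⟨fun k => if hk : k < N then (2 : ℝ) ^ i • x (g ⟨k, hk⟩) else 0, fun k hk => ?_,
    fun ι _ _ f hf hfN => ?_⟩
  · obtain ⟨-, h1, h2⟩ := hgb ⟨k, hk⟩
    simp only [hk, dif_pos, norm_smul, norm_pow, Real.norm_ofNat]
    rw [pow_succ, inv_pow] at h1
    rw [inv_pow] at h2
    have h3 : (0 : ℝ) < 2 ^ i := by positivity
    constructor
    · rw [inv_mul_le_iff₀ h3] at h1
      linarith
    · rwa [← le_inv_mul_iff₀ h3, mul_one]
  · let g' : ι → Fin n := fun k => g ⟨f k, hfN k⟩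
    have hg' : Function.Injective g' := fun a b hab => hf (by simpa using g.injective hab)
    have h1 : (fun k => if hk : f k < N then (2 : ℝ) ^ i • x (g ⟨f k, hk⟩) else 0) =
        fun k => (2 : ℝ) ^ i • x (g' k) := funext fun k => dif_pos (hfN k)
    rw [h1, radSq_smul, ← radSqOn_map hg']
    have h2 := hB (Finset.univ.map ⟨g', hg'⟩) (by
      intro j hj
      obtain ⟨k, -, rfl⟩ := Finset.mem_map.1 hj
      exact (hgb _).1)
    have h3 : ∑ j ∈ Finset.univ.map ⟨g', hg'⟩, ‖x j‖ ^ s ≤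
        Fintype.card ι * ((2⁻¹ : ℝ) ^ i) ^ s := by
      rw [Finset.sum_map]
      refine (Finset.sum_le_card_nsmul _ _ (((2⁻¹ : ℝ) ^ i) ^ s) fun k _ =>
        Real.rpow_le_rpow (norm_nonneg _) (hgb _).2.2 hs0.le).trans_eq ?_
      rw [Finset.card_univ, nsmul_eq_mul]
    have h4 : radSqOn (Finset.univ.map ⟨g', hg'⟩) x ^ (s / 2) ≤
        4 * Fintype.card ι * ((2⁻¹ : ℝ) ^ i) ^ s := by linarith
    have h5 := Real.rpow_le_rpow (Real.rpow_nonneg (radSqOn_nonneg _ _) _) h4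
      (show 0 ≤ 2 / s by positivity)
    rw [← Real.rpow_mul (radSqOn_nonneg _ _), Real.mul_rpow (by positivity) (by positivity),
      ← Real.rpow_mul (by positivity), show s / 2 * (2 / s) = 1 by field_simp, Real.rpow_one,
      mul_div_cancel₀ _ hs0.ne', Real.rpow_two] at h5
    calc ((2 : ℝ) ^ i) ^ 2 * radSqOn (Finset.univ.map ⟨g', hg'⟩) x
        ≤ ((2 : ℝ) ^ i) ^ 2 * ((4 * Fintype.card ι : ℝ) ^ (2 / s) * ((2⁻¹ : ℝ) ^ i) ^ 2) := by gcongr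
      _ = (4 * Fintype.card ι : ℝ) ^ (2 / s) := by
          rw [inv_pow]
          field_simp

end Pigeonhole

section Spreading

open Filter Topology

/-- The limit of a real sequence along a fixed free ultrafilter. -/
noncomputable def ulim (u : ℕ → ℝ) : ℝ := limUnder (hyperfilter ℕ : Filter ℕ) u

lemma tendsto_ulim {u : ℕ → ℝ} {a b : ℝ} (h : ∀ n, u n ∈ Set.Icc a b) :
    Tendsto u (hyperfilter ℕ) (𝓝 (ulim u)) := by
  obtain ⟨x, -, hx⟩ := isCompact_Icc.ultrafilter_le_nhds ((hyperfilter ℕ).map u)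
    (le_principal_iff.2 (mem_map.2 (Eventually.of_forall h)))
  exact tendsto_nhds_limUnder ⟨x, hx⟩

lemma ulim_mem_Icc {u : ℕ → ℝ} {a b : ℝ} (h : ∀ n, u n ∈ Set.Icc a b) : ulim u ∈ Set.Icc a b :=
  isClosed_Icc.mem_of_tendsto (tendsto_ulim h) (Eventually.of_forall h)

lemma eventually_hyperfilter_ge (N : ℕ) : ∀ᶠ n in (hyperfilter ℕ : Filter ℕ), N ≤ n :=
  Nat.hyperfilter_le_atTop (eventually_ge_atTop N)

variable {V : Type*} [AddCommGroup V] [Module ℝ V]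

/-- Convex functions that are `1`-Lipschitz for the seminorm `p`. -/
structure ConvexLip (p : Seminorm ℝ V) (h : V → ℝ) : Prop where
  convexOn : ConvexOn ℝ Set.univ h
  le_add : ∀ v w, h v ≤ h w + p (v - w)

lemma Seminorm.convexLip (p : Seminorm ℝ V) : ConvexLip p p where
  convexOn := p.convexOn
  le_add v w := by simpa using map_add_le_add p w (v - w)

/-- The operator `h ↦ lim_i lim_j h (· + c (e i - e j))`. -/
noncomputable def spread (e : ℕ → V) (c : ℝ) (h : V → ℝ) (v : V) : ℝ :=
  ulim fun i => ulim fun j => h (v + c • (e i - e j))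

variable {p : Seminorm ℝ V} {e : ℕ → V} {h h' : V → ℝ}

lemma seminorm_smul_sub_le (he : ∀ i, p (e i) ≤ 1) (c : ℝ) (i j : ℕ) :
    p (c • (e i - e j)) ≤ 2 * |c| := by
  rw [map_smul_eq_mul, Real.norm_eq_abs]
  have h1 := map_sub_le_add p (e i) (e j)
  nlinarith [he i, he j, abs_nonneg c]

lemma ConvexLip.mem_Icc (hh : ConvexLip p h) (he : ∀ i, p (e i) ≤ 1) (c : ℝ) (v : V) (i j : ℕ) :
    h (v + c • (e i - e j)) ∈ Set.Icc (h v - 2 * |c|) (h v + 2 * |c|) := by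
  have h1 := hh.le_add (v + c • (e i - e j)) v
  have h2 := hh.le_add v (v + c • (e i - e j))
  have h3 := seminorm_smul_sub_le he c i j
  rw [add_sub_cancel_left] at h1
  rw [sub_add_cancel_left, map_neg_eq_map] at h2
  constructor <;> linarith

lemma ConvexLip.tendsto_inner (hh : ConvexLip p h) (he : ∀ i, p (e i) ≤ 1) (c : ℝ) (v : V)
    (i : ℕ) : Tendsto (fun j => h (v + c • (e i - e j))) (hyperfilter ℕ)
      (𝓝 (ulim fun j => h (v + c • (e i - e j)))) :=
  tendsto_ulim (hh.mem_Icc he c v i)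

lemma ConvexLip.tendsto_spread (hh : ConvexLip p h) (he : ∀ i, p (e i) ≤ 1) (c : ℝ) (v : V) :
    Tendsto (fun i => ulim fun j => h (v + c • (e i - e j))) (hyperfilter ℕ)
      (𝓝 (spread e c h v)) :=
  tendsto_ulim fun i => ulim_mem_Icc (hh.mem_Icc he c v i)

lemma ConvexLip.spread (hh : ConvexLip p h) (he : ∀ i, p (e i) ≤ 1) (c : ℝ) :
    ConvexLip p (spread e c h) where
  convexOn := by
    refine ⟨convex_univ, fun v _ w _ a b ha hb hab => ?_⟩
    refine le_of_tendsto_of_tendsto' (hh.tendsto_spread he c _)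
      (((hh.tendsto_spread he c v).const_smul a).add ((hh.tendsto_spread he c w).const_smul b))
      fun i => ?_
    refine le_of_tendsto_of_tendsto' (hh.tendsto_inner he c _ i)
      (((hh.tendsto_inner he c v i).const_smul a).add ((hh.tendsto_inner he c w i).const_smul b))
      fun j => ?_
    have h1 : a • v + b • w + c • (e i - e j) =
        a • (v + c • (e i - e j)) + b • (w + c • (e i - e j)) := by
      rw [smul_add, smul_add, add_add_add_comm, ← add_smul, hab, one_smul]
    rw [h1]
    exact hh.convexOn.2 (Set.mem_univ _) (Set.mem_univ _) ha hb hab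
  le_add v w := by
    refine le_of_tendsto_of_tendsto' (hh.tendsto_spread he c v)
      ((hh.tendsto_spread he c w).add_const _) fun i => ?_
    refine le_of_tendsto_of_tendsto' (hh.tendsto_inner he c v i)
      ((hh.tendsto_inner he c w i).add_const _) fun j => ?_
    simpa using hh.le_add (v + c • (e i - e j)) (w + c • (e i - e j))

lemma spread_mono (hh : ConvexLip p h) (hh' : ConvexLip p h') (he : ∀ i, p (e i) ≤ 1) (c : ℝ)
    (hle : ∀ v, h v ≤ h' v) (v : V) : spread e c h v ≤ spread e c h' v :=
  le_of_tendsto_of_tendsto' (hh.tendsto_spread he c v) (hh'.tendsto_spread he c v) fun i =>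
    le_of_tendsto_of_tendsto' (hh.tendsto_inner he c v i) (hh'.tendsto_inner he c v i) fun _ =>
      hle _

lemma spread_zero (h : V → ℝ) (v : V) : spread e 0 h v = h v := by
  simp [spread, ulim, tendsto_const_nhds.limUnder_eq]

lemma ConvexLip.le_spread (hh : ConvexLip p h) (he : ∀ i, p (e i) ≤ 1) (c : ℝ) (v : V) :
    h v ≤ _root_.spread e c h v := by
  refine le_of_forall_pos_le_add fun η hη => ?_
  set l := _root_.spread e c h v
  let S : Set ℕ := {i | ulim (fun j => h (v + c • (e i - e j))) < l + η}
  have hS : ∀ᶠ i in (hyperfilter ℕ : Filter ℕ), i ∈ S :=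
    (hh.tendsto_spread he c v).eventually_lt_const (lt_add_of_pos_right l hη)
  have hstep : ∀ i : S, ∃ j : S, h (v + c • (e i - e j)) < l + η := by
    rintro ⟨i, hi⟩
    obtain ⟨j, hj1, hj2⟩ := (hS.and ((hh.tendsto_inner he c v i).eventually_lt_const hi)).exists
    exact ⟨⟨j, hj1⟩, hj2⟩
  choose next hnext using hstep
  obtain ⟨i₀, hi₀⟩ := hS.exists
  let a : ℕ → S := fun m => next^[m] ⟨i₀, hi₀⟩
  have ha : ∀ m, h (v + c • (e (a m) - e (a (m + 1)))) < l + η := fun m => by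
    simp only [a, Function.iterate_succ_apply']
    exact hnext _
  have hM : ∀ M : ℕ, h v ≤ l + η + 2 * |c| * (1 / ((M : ℝ) + 1)) := by
    intro M
    have hM0 : (0 : ℝ) < (M : ℝ) + 1 := by positivity
    have h1 := hh.convexOn.map_sum_le (t := Finset.range (M + 1))
      (w := fun _ => 1 / ((M : ℝ) + 1))
      (p := fun m => v + c • (e (a m) - e (a (m + 1)))) (fun _ _ => by positivity)
      (by simp [field]) (fun _ _ => Set.mem_univ _)
    have h2 : ∑ m ∈ Finset.range (M + 1), (1 / ((M : ℝ) + 1)) •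
        h (v + c • (e (a m) - e (a (m + 1)))) ≤ l + η := by
      refine (Finset.sum_le_sum fun m _ => smul_le_smul_of_nonneg_left (ha m).le
        (by positivity)).trans_eq ?_
      rw [Finset.sum_const, Finset.card_range, nsmul_eq_mul, smul_eq_mul]
      push_cast
      field_simp
    have h3 : ∑ m ∈ Finset.range (M + 1), (1 / ((M : ℝ) + 1)) •
        (v + c • (e (a m) - e (a (m + 1)))) =
        v + (1 / ((M : ℝ) + 1)) • c • (e (a 0) - e (a (M + 1))) := by
      rw [← Finset.smul_sum, Finset.sum_add_distrib, ← Finset.smul_sum,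
        Finset.sum_range_sub' (fun m => e (a m)), smul_add, Finset.sum_const, Finset.card_range,
        ← Nat.cast_smul_eq_nsmul ℝ, smul_smul]
      push_cast
      rw [one_div_mul_cancel hM0.ne', one_smul]
    rw [h3] at h1
    have h4 := hh.le_add v (v + (1 / ((M : ℝ) + 1)) • c • (e (a 0) - e (a (M + 1))))
    rw [sub_add_cancel_left, map_neg_eq_map, map_smul_eq_mul,
      Real.norm_of_nonneg (by positivity)] at h4
    have h5 := mul_le_mul_of_nonneg_left (seminorm_smul_sub_le he c (a 0) (a (M + 1)))
      (show 0 ≤ 1 / ((M : ℝ) + 1) by positivity)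
    linarith
  have h6 : Tendsto (fun M : ℕ => l + η + 2 * |c| * (1 / ((M : ℝ) + 1))) atTop
      (𝓝 (l + η + 2 * |c| * 0)) :=
    (tendsto_one_div_add_atTop_nhds_zero_nat.const_mul _).const_add _
  rw [mul_zero, add_zero] at h6
  exact ge_of_tendsto' h6 hM

/-- The iterated limit of `p (v + ∑ m < k, c m • (e (i m) - e (j m)))`. -/
noncomputable def iterSpread (p : Seminorm ℝ V) (e : ℕ → V) : ℕ → (ℕ → ℝ) → V → ℝ
  | 0, _ => p
  | k + 1, c => spread e (c 0) (iterSpread p e k fun m => c (m + 1))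

lemma convexLip_iterSpread (he : ∀ i, p (e i) ≤ 1) (k : ℕ) (c : ℕ → ℝ) :
    ConvexLip p (iterSpread p e k c) := by
  induction k generalizing c with
  | zero => exact p.convexLip
  | succ k ih => exact (ih _).spread he _

lemma iterSpread_suppress (he : ∀ i, p (e i) ≤ 1) (k : ℕ) {c c' : ℕ → ℝ}
    (hc : ∀ m, c' m = c m ∨ c' m = 0) (v : V) : iterSpread p e k c' v ≤ iterSpread p e k c v := by
  induction k generalizing c c' v with
  | zero => exact le_rfl
  | succ k ih =>
    have h1 := convexLip_iterSpread he k fun m => c (m + 1)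
    have h2 := convexLip_iterSpread he k fun m => c' (m + 1)
    have h3 := ih (fun m => hc (m + 1))
    rcases hc 0 with h0 | h0
    · rw [iterSpread, iterSpread, h0]
      exact spread_mono h2 h1 he _ h3 v
    · rw [iterSpread, iterSpread, h0, spread_zero]
      exact (h3 v).trans (h1.le_spread he _ v)

lemma spread_le_iterSpread (he : ∀ i, p (e i) ≤ 1) {k m : ℕ} (hm : m < k) (c : ℕ → ℝ) (v : V) :
    spread e (c m) p v ≤ iterSpread p e k c v := by
  induction k generalizing c m v with
  | zero => exact absurd hm (Nat.not_lt_zero _)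
  | succ k ih =>
    have h1 := convexLip_iterSpread he k fun m => c (m + 1)
    rw [iterSpread]
    cases m with
    | zero =>
      refine spread_mono p.convexLip h1 he _ (fun w => ?_) v
      have h2 : ∀ (k : ℕ) (c : ℕ → ℝ), p w ≤ iterSpread p e k c w := by
        intro k
        induction k with
        | zero => exact fun _ => le_rfl
        | succ k ihk =>
          exact fun c => (ihk _).trans ((convexLip_iterSpread he k _).le_spread he _ w)
      exact h2 k _
    | succ m =>
      exact (ih (Nat.lt_of_succ_lt_succ hm) (fun m => c (m + 1)) v).trans (h1.le_spread he _ v)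

/-- Finitely many iterated limits are approximated simultaneously along increasing indices. -/
lemma exists_approx_iterSpread (he : ∀ i, p (e i) ≤ 1) {ι : Type*} [Finite ι] (k : ℕ)
    (c : ι → ℕ → ℝ) (v : ι → V) (N : ℕ) {η : ℝ} (hη : 0 < η) :
    ∃ f g : ℕ → ℕ, (∀ m < k, N ≤ f m ∧ f m < g m) ∧ (∀ m m', m < m' → m' < k → g m < f m') ∧
      ∀ a, |p (v a + ∑ m ∈ Finset.range k, c a m • (e (f m) - e (g m))) -
        iterSpread p e k (c a) (v a)| < η := by
  induction k generalizing c v N η with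
  | zero => exact ⟨id, id, by simp, by simp, by simpa [iterSpread] using fun _ => hη⟩
  | succ k ih =>
    have hη3 : 0 < η / 3 := by positivity
    have hL := fun a => convexLip_iterSpread he k fun m => c a (m + 1)
    have h1 : ∀ᶠ i in (hyperfilter ℕ : Filter ℕ), N ≤ i ∧ ∀ a,
        dist (ulim fun j => iterSpread p e k (fun m => c a (m + 1)) (v a + c a 0 • (e i - e j)))
          (iterSpread p e (k + 1) (c a) (v a)) < η / 3 :=
      (eventually_hyperfilter_ge N).and (eventually_all.2 fun a =>
        Metric.tendsto_nhds.1 ((hL a).tendsto_spread he (c a 0) (v a)) _ hη3)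
    obtain ⟨i, hiN, hi⟩ := h1.exists
    have h2 : ∀ᶠ j in (hyperfilter ℕ : Filter ℕ), i + 1 ≤ j ∧ ∀ a,
        dist (iterSpread p e k (fun m => c a (m + 1)) (v a + c a 0 • (e i - e j)))
          (ulim fun j => iterSpread p e k (fun m => c a (m + 1)) (v a + c a 0 • (e i - e j)))
          < η / 3 :=
      (eventually_hyperfilter_ge (i + 1)).and (eventually_all.2 fun a =>
        Metric.tendsto_nhds.1 ((hL a).tendsto_inner he (c a 0) (v a) i) _ hη3)
    obtain ⟨j, hij, hj⟩ := h2.exists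
    obtain ⟨f, g, hfg, hgf, hp⟩ := ih (fun a m => c a (m + 1))
      (fun a => v a + c a 0 • (e i - e j)) (j + 1) hη3
    refine ⟨fun m => Nat.casesOn m i f, fun m => Nat.casesOn m j g, fun m hm => ?_,
      fun m m' hmm hm' => ?_, fun a => ?_⟩
    · cases m with
      | zero => exact ⟨hiN, hij⟩
      | succ m =>
        have := hfg m (by omega)
        exact ⟨show N ≤ f m by omega, this.2⟩
    · cases m' with
      | zero => omega
      | succ m' =>
        have h3 := hfg m' (by omega)
        cases m with
        | zero =>
          change j < f m'
          omega
        | succ m => exact hgf m m' (by omega) (by omega)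
    · have h3 := hi a
      have h4 := hj a
      have h5 := hp a
      rw [Real.dist_eq] at h3 h4
      rw [Finset.sum_range_succ', add_comm (∑ m ∈ Finset.range k, _), ← add_assoc]
      change |p (v a + c a 0 • (e i - e j) + ∑ m ∈ Finset.range k, c a (m + 1) • (e (f m) - e (g m)))
        - iterSpread p e (k + 1) (c a) (v a)| < η
      rw [abs_lt] at h3 h4 h5 ⊢
      constructor <;> linarith [h3.1, h3.2, h4.1, h4.2, h5.1, h5.2]

end Spreading

section Subsequence

open Filter Topology

variable {V : Type*} [AddCommGroup V] [Module ℝ V] {p : Seminorm ℝ V} {e : ℕ → V}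

lemma exists_rpow_four_mul_le {a : ℝ} (ha : a < 1) :
    ∃ M : ℕ, 0 < M ∧ (4 * M : ℝ) ^ a ≤ M / 32 := by
  have h1 : Tendsto (fun M : ℕ => (4 * M : ℝ) ^ (1 - a)) atTop atTop :=
    (tendsto_rpow_atTop (sub_pos.2 ha)).comp
      (tendsto_natCast_atTop_atTop.const_mul_atTop (by norm_num))
  obtain ⟨M, hM, hM0⟩ := ((h1.eventually_ge_atTop 128).and (eventually_gt_atTop 0)).exists
  refine ⟨M, hM0, ?_⟩
  have hM' : (0 : ℝ) < M := by exact_mod_cast hM0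
  rw [Real.rpow_sub (by positivity), Real.rpow_one, le_div_iff₀ (by positivity)] at hM
  linarith

lemma add_seminorm_sq_le (x y : V) : p (x + y) ^ 2 ≤ 2 * p x ^ 2 + 2 * p y ^ 2 := by
  have h1 := map_add_le_add p x y
  have h2 := apply_nonneg p (x + y)
  nlinarith [sq_nonneg (p x - p y), apply_nonneg p x, apply_nonneg p y]

/-- Rademacher sums of distinct terms of `e` satisfy an upper `s`-estimate for `p`. -/
def RadUpper (p : Seminorm ℝ V) (e : ℕ → V) (s : ℝ) : Prop :=
  ∀ (ι : Type) [Fintype ι] [DecidableEq ι] (f : ι → ℕ), Function.Injective f →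
    signAvg (fun ε : ι → Bool => p (∑ j, boolSign (ε j) • e (f j)) ^ 2) ≤
      (4 * Fintype.card ι : ℝ) ^ (2 / s)

lemma exists_pos_le_spread {s : ℝ} (hs : 2 < s) (he : ∀ i, p (e i) ≤ 1)
    (he' : ∀ i, 1 / 2 ≤ p (e i)) (hrad : RadUpper p e s) : ∃ c : ℝ, 0 < c ∧ c ≤ spread e 1 p 0 := by
  classical
  obtain ⟨M, hM0, hM⟩ := exists_rpow_four_mul_le (a := 2 / s)
    ((div_lt_one (by linarith)).2 hs)
  have hM' : (1 : ℝ) ≤ M := by exact_mod_cast hM0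
  refine ⟨1 / (8 * M), by positivity, ?_⟩
  by_contra! hcon
  obtain ⟨i, hi⟩ := ((p.convexLip.tendsto_spread he 1 0).eventually_lt_const hcon).exists
  have h1 := (p.convexLip.tendsto_inner he 1 0 i).eventually_lt_const hi
  have h2 : {j | p (0 + (1 : ℝ) • (e i - e j)) < 1 / (8 * M)}.Infinite := fun hfin =>
    hfin.notMem_hyperfilter h1
  obtain ⟨J, hJ, hJM⟩ := h2.exists_subset_card_eq M
  have h3 : ∀ ε : J → Bool, (∑ j, boolSign (ε j)) ^ 2 * (1 / 4) ≤
      2 * p (∑ j, boolSign (ε j) • e j) ^ 2 + 1 / 32 := by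
    intro ε
    have h4 : (∑ j, boolSign (ε j)) • e i =
        ∑ j, boolSign (ε j) • e j + ∑ j : J, boolSign (ε j) • (e i - e j) := by
      rw [Finset.sum_smul, ← Finset.sum_add_distrib]
      exact Finset.sum_congr rfl fun j _ => by rw [← smul_add, add_sub_cancel]
    have h5 := add_seminorm_sq_le (p := p) (∑ j, boolSign (ε j) • e j)
      (∑ j : J, boolSign (ε j) • (e i - e j))
    rw [← h4, map_smul_eq_mul, mul_pow, Real.norm_eq_abs, sq_abs] at h5
    have h6 : p (∑ j : J, boolSign (ε j) • (e i - e j)) ≤ 1 / 8 := by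
      calc p (∑ j : J, boolSign (ε j) • (e i - e j))
          ≤ ∑ j : J, p (boolSign (ε j) • (e i - e j)) := Finset.le_sum_of_subadditive p
            (map_zero p).le (map_add_le_add p) _ _
        _ ≤ ∑ _j : J, 1 / (8 * (M : ℝ)) := Finset.sum_le_sum fun j _ => by
            rw [map_smul_eq_mul, Real.norm_eq_abs, abs_boolSign, one_mul]
            have h6 : p (0 + (1 : ℝ) • (e i - e j)) < 1 / (8 * M) := hJ j.2
            rw [zero_add, one_smul] at h6
            exact h6.le
        _ = 1 / 8 := by
            rw [Finset.sum_const, Finset.card_univ, Fintype.card_coe, hJM, nsmul_eq_mul]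
            field_simp
    have h7 := apply_nonneg p (∑ j : J, boolSign (ε j) • (e i - e j))
    have h8 : (1 / 4 : ℝ) ≤ p (e i) ^ 2 := by nlinarith [he' i]
    nlinarith [mul_le_mul_of_nonneg_left h8 (sq_nonneg (∑ j, boolSign (ε j)))]
  have h4 := signAvg_mono h3
  have h5 := hrad J (fun j => j) Subtype.val_injective
  rw [signAvg_add, signAvg_const, signAvg_const_mul] at h4
  simp only [mul_comm _ (1 / 4 : ℝ)] at h4
  rw [signAvg_const_mul, signAvg_sum_sq] at h4
  rw [Fintype.card_coe, hJM] at h4 h5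
  linarith

/-- Among the differences `e i - e j` there are arbitrarily long families with an upper estimate
for all sums over sets. -/
lemma exists_subset_sums_le {s : ℝ} (hs : 2 < s) (he : ∀ i, p (e i) ≤ 1)
    (he' : ∀ i, 1 / 2 ≤ p (e i)) (hrad : RadUpper p e s) :
    ∃ c : ℝ, 0 < c ∧ ∀ k : ℕ, ∃ z : ℕ → V, (∀ m < k, c ≤ p (z m)) ∧
      ∀ A ⊆ Finset.range k, p (∑ m ∈ A, z m) ≤ 20 * (A.card : ℝ) ^ (1 / s) := by
  classical
  have hs0 : 0 < s := by linarith
  obtain ⟨c, hc, hcle⟩ := exists_pos_le_spread hs he he' hrad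
  refine ⟨c / 2, by positivity, fun k => ?_⟩
  let co : (Finset.range k).powerset × (Finset.range k).powerset → ℕ → ℝ := fun a m =>
    if m ∈ a.1.1 then (if m ∈ a.2.1 then 1 else -1) else 0
  have hη : 0 < min (c / 2) 1 := lt_min (by positivity) one_pos
  obtain ⟨f, g, hfg, hgf, hp⟩ := exists_approx_iterSpread he k co (fun _ => 0) 0 hη
  let z : ℕ → V := fun m => e (f m) - e (g m)
  have hz : ∀ {A B : Finset ℕ} (hA : A ⊆ Finset.range k) (hB : B ⊆ Finset.range k),
      |p (∑ m ∈ A, (if m ∈ B then (1 : ℝ) else -1) • z m) -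
        iterSpread p e k (co (⟨A, Finset.mem_powerset.2 hA⟩, ⟨B, Finset.mem_powerset.2 hB⟩)) 0|
        < min (c / 2) 1 := by
    intro A B hA hB
    have h1 := hp (⟨A, Finset.mem_powerset.2 hA⟩, ⟨B, Finset.mem_powerset.2 hB⟩)
    have h2 : ∑ m ∈ Finset.range k, co (⟨A, Finset.mem_powerset.2 hA⟩,
        ⟨B, Finset.mem_powerset.2 hB⟩) m • (e (f m) - e (g m)) =
        ∑ m ∈ A, (if m ∈ B then (1 : ℝ) else -1) • z m := by
      rw [← Finset.sum_subset hA]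
      · exact Finset.sum_congr rfl fun m hm => by simp only [co, if_pos hm, z]
      · intro m _ hm
        simp only [co, if_neg hm, zero_smul]
    rwa [zero_add, h2] at h1
  refine ⟨z, fun m hm => ?_, fun A hA => ?_⟩
  · have h1 : ({m} : Finset ℕ) ⊆ Finset.range k := by simpa using hm
    have h2 := (abs_lt.1 (hz h1 h1)).1
    have h3 := spread_le_iterSpread (p := p) he hm
      (co (⟨{m}, Finset.mem_powerset.2 h1⟩, ⟨{m}, Finset.mem_powerset.2 h1⟩)) 0
    have h4 : co (⟨{m}, Finset.mem_powerset.2 h1⟩, ⟨{m}, Finset.mem_powerset.2 h1⟩) m = 1 := by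
      simp [co]
    rw [h4] at h3
    have h5 : p (∑ i ∈ {m}, (if i ∈ ({m} : Finset ℕ) then (1 : ℝ) else -1) • z i) = p (z m) := by
      simp
    rw [h5] at h2
    linarith [min_le_left (c / 2) (1 : ℝ)]
  rcases A.eq_empty_or_nonempty with rfl | hne
  · simp [Real.zero_rpow (inv_ne_zero hs0.ne')]
  have hinj : ∀ {u : ℕ → ℕ}, (∀ m m', m < m' → m' < k → u m < u m') →
      Function.Injective fun m : A => u m := by
    rintro u hu ⟨m, hm⟩ ⟨m', hm'⟩ hmm
    have hmk := Finset.mem_range.1 (hA hm)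
    have hmk' := Finset.mem_range.1 (hA hm')
    rw [Subtype.mk.injEq]
    by_contra hne
    rcases lt_or_gt_of_ne hne with h | h
    · exact (hu _ _ h hmk').ne hmm
    · exact (hu _ _ h hmk).ne' hmm
  have h1 := hrad A (fun m => f m) (hinj fun m m' h h' =>
    (hfg m (h.trans h')).2.trans (hgf m m' h h'))
  have h2 := hrad A (fun m => g m) (hinj fun m m' h h' => (hgf m m' h h').trans (hfg m' h').2)
  have h3 : ∀ ε : A → Bool, p (∑ m, boolSign (ε m) • z m) ^ 2 ≤
      2 * p (∑ m, boolSign (ε m) • e (f m)) ^ 2 + 2 * p (∑ m, boolSign (ε m) • e (g m)) ^ 2 := by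
    intro ε
    have h4 := add_seminorm_sq_le (p := p) (∑ m, boolSign (ε m) • e (f m))
      (-∑ m, boolSign (ε m) • e (g m))
    rw [← sub_eq_add_neg, ← Finset.sum_sub_distrib, map_neg_eq_map] at h4
    simpa only [← smul_sub] using h4
  have h4 := signAvg_mono h3
  rw [signAvg_add, signAvg_const_mul, signAvg_const_mul] at h4
  obtain ⟨ε, hε⟩ := exists_le_of_signAvg_le (h4.trans (show _ ≤
    4 * (4 * Fintype.card A : ℝ) ^ (2 / s) by linarith))
  set r : ℝ := (A.card : ℝ) ^ (1 / s) with hr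
  have hr1 : 1 ≤ r := Real.one_le_rpow (by exact_mod_cast hne.card_pos) (by positivity)
  have hε' : p (∑ m, boolSign (ε m) • z m) ≤ 8 * r := by
    have h5 : 4 * (4 * Fintype.card A : ℝ) ^ (2 / s) ≤ (8 * r) ^ 2 := by
      rw [Fintype.card_coe, Real.mul_rpow (by norm_num) (by positivity), mul_pow, hr,
        ← Real.rpow_natCast (_ ^ (1 / s)), ← Real.rpow_mul (by positivity)]
      have h6 : (4 : ℝ) ^ (2 / s) ≤ 4 := by
        conv_rhs => rw [← Real.rpow_one 4]
        exact Real.rpow_le_rpow_of_exponent_le (by norm_num)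
          ((div_le_one hs0).2 hs.le)
      have h7 : 1 / s * ((2 : ℕ) : ℝ) = 2 / s := by push_cast; ring
      rw [h7]
      have h8 : (0 : ℝ) ≤ (A.card : ℝ) ^ (2 / s) := by positivity
      nlinarith
    exact le_of_sq_le_sq (hε.trans h5) (by positivity)
  let B : Finset ℕ := A.filter fun m => ∃ h : m ∈ A, ε ⟨m, h⟩ = true
  have hBA : B ⊆ A := Finset.filter_subset _ _
  have hsum : ∑ m : A, boolSign (ε m) • z m =
      ∑ m ∈ A, (if m ∈ B then (1 : ℝ) else -1) • z m := by
    rw [← Finset.sum_coe_sort A]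
    refine Finset.sum_congr rfl fun m _ => ?_
    have : (m : ℕ) ∈ B ↔ ε m = true := by simp [B]
    simp only [this, boolSign]
  have hmain := hz hA (hBA.trans hA)
  rw [← hsum] at hmain
  have hB := hz (hBA.trans hA) (hBA.trans hA)
  have hAB := hz (A := A \ B) (B := ∅) (Finset.sdiff_subset.trans hA) (Finset.empty_subset _)
  have hB1 : ∑ m ∈ B, (if m ∈ B then (1 : ℝ) else -1) • z m = ∑ m ∈ B, z m :=
    Finset.sum_congr rfl fun m hm => by rw [if_pos hm, one_smul]
  have hAB1 : ∑ m ∈ A \ B, (if m ∈ (∅ : Finset ℕ) then (1 : ℝ) else -1) • z m =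
      -∑ m ∈ A \ B, z m := by
    rw [← Finset.sum_neg_distrib]
    exact Finset.sum_congr rfl fun m hm => by simp
  rw [hB1] at hB
  rw [hAB1, map_neg_eq_map] at hAB
  have hsB := iterSpread_suppress (p := p) he k
    (c := co (⟨A, Finset.mem_powerset.2 hA⟩, ⟨B, Finset.mem_powerset.2 (hBA.trans hA)⟩))
    (c' := co (⟨B, Finset.mem_powerset.2 (hBA.trans hA)⟩,
      ⟨B, Finset.mem_powerset.2 (hBA.trans hA)⟩)) (fun m => by
      by_cases hm : m ∈ B
      · simp [co, hm, hBA hm]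
      · simp [co, hm]) 0
  have hsAB := iterSpread_suppress (p := p) he k
    (c := co (⟨A, Finset.mem_powerset.2 hA⟩, ⟨B, Finset.mem_powerset.2 (hBA.trans hA)⟩))
    (c' := co (⟨A \ B, Finset.mem_powerset.2 (Finset.sdiff_subset.trans hA)⟩,
      ⟨∅, Finset.mem_powerset.2 (Finset.empty_subset _)⟩)) (fun m => by
      by_cases hm : m ∈ B
      · simp [co, hm]
      · by_cases hm' : m ∈ A <;> simp [co, hm, hm']) 0
  have htri := map_add_le_add p (∑ m ∈ A \ B, z m) (∑ m ∈ B, z m)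
  rw [Finset.sum_sdiff hBA] at htri
  have hmin := min_le_right (c / 2) (1 : ℝ)
  linarith [(abs_lt.1 hmain).1, (abs_lt.1 hB).2, (abs_lt.1 hAB).2]

end Subsequence

section CotypeIndex

open Filter Topology

variable {Y : Type*} [NormedAddCommGroup Y] [NormedSpace ℝ Y]

lemma norm_linearCombination_mem_Icc {y : ℕ → Y} (hy : ∀ i, ‖y i‖ ≤ 1) (v : ℕ →₀ ℝ) :
    ‖Finsupp.linearCombination ℝ y v‖ ∈ Set.Icc 0 (∑ i ∈ v.support, |v i|) := by
  refine ⟨norm_nonneg _, ?_⟩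
  rw [Finsupp.linearCombination_apply, Finsupp.sum]
  refine (norm_sum_le _ _).trans (Finset.sum_le_sum fun i _ => ?_)
  rw [norm_smul, Real.norm_eq_abs]
  exact mul_le_of_le_one_right (abs_nonneg _) (hy i)

lemma tendsto_ulim_norm_linearCombination {y : ℕ → ℕ → Y} (hy : ∀ N i, ‖y N i‖ ≤ 1)
    (v : ℕ →₀ ℝ) : Tendsto (fun N => ‖Finsupp.linearCombination ℝ (y N) v‖) (hyperfilter ℕ)
      (𝓝 (ulim fun N => ‖Finsupp.linearCombination ℝ (y N) v‖)) :=
  tendsto_ulim fun N => norm_linearCombination_mem_Icc (hy N) v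

/-- The seminorm on finitely supported sequences obtained as the limit of `‖∑ j, v j • y N j‖`
along a free ultrafilter in `N`. -/
noncomputable def limSeminorm (y : ℕ → ℕ → Y) (hy : ∀ N i, ‖y N i‖ ≤ 1) : Seminorm ℝ (ℕ →₀ ℝ) :=
  Seminorm.of (fun v => ulim fun N => ‖Finsupp.linearCombination ℝ (y N) v‖)
    (fun v w => le_of_tendsto_of_tendsto' (tendsto_ulim_norm_linearCombination hy _)
      ((tendsto_ulim_norm_linearCombination hy v).add (tendsto_ulim_norm_linearCombination hy w))
      fun N => by
        rw [map_add]
        exact norm_add_le _ _)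
    (fun c v => tendsto_nhds_unique (tendsto_ulim_norm_linearCombination hy _)
      (((tendsto_ulim_norm_linearCombination hy v).const_mul ‖c‖).congr fun N => by
        rw [map_smul, norm_smul]))

lemma tendsto_limSeminorm (y : ℕ → ℕ → Y) (hy : ∀ N i, ‖y N i‖ ≤ 1) (v : ℕ →₀ ℝ) :
    Tendsto (fun N => ‖Finsupp.linearCombination ℝ (y N) v‖) (hyperfilter ℕ)
      (𝓝 (limSeminorm y hy v)) :=
  tendsto_ulim_norm_linearCombination hy v

lemma exists_subset_sums_le_of_not_hasCotype {s : ℝ} (hs : 2 < s) (h : ¬HasCotype Y s) :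
    ∃ c : ℝ, 0 < c ∧ ∀ k : ℕ, ∃ z : ℕ → Y, (∀ m < k, c ≤ ‖z m‖) ∧
      ∀ A ⊆ Finset.range k, ‖∑ m ∈ A, z m‖ ≤ 21 * (A.card : ℝ) ^ (1 / s) := by
  have hs0 : 0 < s := by linarith
  choose x hx1 hx2 using exists_radSq_le hs.le h
  let y : ℕ → ℕ → Y := fun N i => if i < N then x N i else 0
  have hyx : ∀ {N i}, i < N → y N i = x N i := fun hi => if_pos hi
  have hy : ∀ N i, ‖y N i‖ ≤ 1 := fun N i => by
    by_cases hi : i < N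
    · rw [hyx hi]
      exact (hx1 N i hi).2
    · simp [y, hi]
  let e : ℕ → ℕ →₀ ℝ := fun i => Finsupp.single i 1
  set p := limSeminorm y hy
  have hLe : ∀ N i, Finsupp.linearCombination ℝ (y N) (e i) = y N i := fun N i => by
    simp [e, Finsupp.linearCombination_single]
  have he : ∀ i, p (e i) ≤ 1 := fun i => le_of_tendsto' (tendsto_limSeminorm y hy (e i)) fun N => by
    rw [hLe]
    exact hy N i
  have he' : ∀ i, 1 / 2 ≤ p (e i) := fun i => by
    refine ge_of_tendsto (tendsto_limSeminorm y hy (e i)) ?_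
    filter_upwards [eventually_hyperfilter_ge (i + 1)] with N hN
    rw [hLe, hyx hN]
    exact (hx1 N i hN).1
  have hrad : RadUpper p e s := by
    intro ι _ _ f hf
    have h1 : Tendsto (fun N => signAvg fun ε : ι → Bool =>
        ‖Finsupp.linearCombination ℝ (y N) (∑ j, boolSign (ε j) • e (f j))‖ ^ 2) (hyperfilter ℕ)
        (𝓝 (signAvg fun ε : ι → Bool => p (∑ j, boolSign (ε j) • e (f j)) ^ 2)) :=
      (tendsto_finsetSum _ fun ε _ => (tendsto_limSeminorm y hy _).pow 2).const_mul _
    refine le_of_tendsto h1 ?_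
    filter_upwards [eventually_all.2 fun j => eventually_hyperfilter_ge (f j + 1)] with N hN
    refine le_of_eq_of_le ?_ (hx2 N ι f hf hN)
    simp only [radSq, map_sum, map_smul, hLe]
    exact congrArg signAvg (funext fun ε => by simp only [hyx (hN _)])
  obtain ⟨c, hc, hz⟩ := exists_subset_sums_le hs he he' hrad
  refine ⟨c / 2, by positivity, fun k => ?_⟩
  obtain ⟨z, hz1, hz2⟩ := hz k
  have h1 : ∀ᶠ N in (hyperfilter ℕ : Filter ℕ), ∀ m ∈ Finset.range k,
      c / 2 < ‖Finsupp.linearCombination ℝ (y N) (z m)‖ :=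
    (Filter.eventually_all_finset _).2 fun m hm =>
      (tendsto_limSeminorm y hy (z m)).eventually_const_lt
        (lt_of_lt_of_le (by linarith) (hz1 m (Finset.mem_range.1 hm)))
  have h2 : ∀ᶠ N in (hyperfilter ℕ : Filter ℕ), ∀ A ∈ (Finset.range k).powerset,
      ‖Finsupp.linearCombination ℝ (y N) (∑ m ∈ A, z m)‖ < 20 * (A.card : ℝ) ^ (1 / s) + 1 :=
    (Filter.eventually_all_finset _).2 fun A hA =>
      (tendsto_limSeminorm y hy _).eventually_lt_const
        (lt_of_le_of_lt (hz2 A (Finset.mem_powerset.1 hA)) (by linarith))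
  obtain ⟨N, hN1, hN2⟩ := (h1.and h2).exists
  refine ⟨fun m => Finsupp.linearCombination ℝ (y N) (z m),
    fun m hm => (hN1 m (Finset.mem_range.2 hm)).le, fun A hA => ?_⟩
  rw [← map_sum]
  rcases A.eq_empty_or_nonempty with rfl | hne
  · simp [Real.zero_rpow (inv_ne_zero hs0.ne')]
  · have h3 := hN2 A (Finset.mem_powerset.2 hA)
    have h4 : (1 : ℝ) ≤ (A.card : ℝ) ^ (1 / s) :=
      Real.one_le_rpow (by exact_mod_cast hne.card_pos) (by positivity)
    linarith

/-- An infinite dimensional space admits upper estimates with some exponent larger than any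
number below its cotype index. -/
lemma exists_hasUpperEstimates (𝕂 : Type*) [RCLike 𝕂] (Y : Type*) [NormedAddCommGroup Y]
    [NormedSpace 𝕂 Y] (hY : ¬FiniteDimensional 𝕂 Y) {q : ℝ}
    (hcot : ∃ s : ℝ, 2 ≤ s ∧ q < s ∧ ¬HasCotype Y s) :
    ∃ t : ℝ, q < t ∧ HasUpperEstimates 𝕂 Y t := by
  rcases lt_or_ge q 2 with hq | hq
  · exact ⟨2, hq, hasUpperEstimates_two hY⟩
  · obtain ⟨s, -, hqs, h⟩ := hcot
    let _ : NormedSpace ℝ Y := NormedSpace.restrictScalars ℝ 𝕂 Y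
    obtain ⟨c, hc, hz⟩ := exists_subset_sums_le_of_not_hasCotype (hq.trans_lt hqs) h
    exact ⟨(q + s) / 2, by linarith,
      hasUpperEstimates_of_subset_sums (by linarith) (by linarith) hc hz⟩

end CotypeIndex

/-- If `Y` is infinite dimensional with `q < cot Y`, and every continuous
`(n₁,…,n_m)`-homogeneous polynomial into `Y` is absolutely `(q;1)`-summing, then the products
of powers of basis coefficients are `t`-summable for every `t > q`. -/
theorem stmt15 (𝕂 : Type*) [RCLike 𝕂]
    (Y : Type*) [NormedAddCommGroup Y] [NormedSpace 𝕂 Y] [CompleteSpace Y]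
    (hY : ¬FiniteDimensional 𝕂 Y)
    (q : ℝ) (hq : 0 < q)
    (hcot : ∃ s : ℝ, 2 ≤ s ∧ q < s ∧ ¬HasCotype Y s)
    (m : ℕ) (hm : 0 < m) (n : Fin m → ℕ) (hn : ∀ k, 1 ≤ n k)
    (X : Fin m → Type*) [∀ k, NormedAddCommGroup (X k)]
    [∀ k, NormedSpace 𝕂 (X k)] [∀ k, CompleteSpace (X k)]
    (e : ∀ k, ℕ → X k) (he : ∀ k, IsNormalizedUncondBasis 𝕂 (X k) (e k))
    (hX : ∀ k, ¬FiniteDimensional 𝕂 (X k))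
    (hsum : ∀ P : (∀ k, X k) → Y, IsMultiPoly 𝕂 n P →
      ∀ x : ∀ k, ℕ → X k, (∀ k, WeaklySummable 𝕂 (x k)) →
        Summable fun j => ‖P fun k => x k j‖ ^ q)
    (t : ℝ) (ht : q < t) (x : ∀ k, X k) (a : ∀ _ : Fin m, ℕ → 𝕂)
    (ha : ∀ k, HasSum (fun j => a k j • e k j) (x k)) :
    Summable fun j => (∏ k, ‖a k j‖ ^ (n k : ℝ)) ^ t := by
  obtain ⟨t₀, hqt₀, hup⟩ := exists_hasUpperEstimates 𝕂 Y hY hcot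
  have hqt : q < min t t₀ := lt_min ht hqt₀
  have hup := hup.anti (hq.trans hqt) (min_le_right t t₀)
  obtain ⟨K, hK0, hK⟩ := exists_uniform_summing_constant hq n X hsum
  choose ρ f hρ hf0 hf1 hf2 using fun k => (he k).exists_coord
  have hle : ∀ k, ρ k ≤ ∑ k, ρ k := fun k =>
    Finset.single_le_sum (fun k _ => zero_le_one.trans (hρ k)) (Finset.mem_univ k)
  have hne : Nonempty (Σ k : Fin m, Fin (n k)) := ⟨⟨⟨0, hm⟩, ⟨0, hn _⟩⟩⟩
  obtain ⟨S₀, hS₀⟩ := exists_sum_prod_coord_le (R := ∑ k, ρ k)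
    ((hρ ⟨0, hm⟩).trans (hle _)) (fun k => (he k).1)
    (fun k B x => (hf1 k B x).trans (mul_le_mul_of_nonneg_right (hle k) (norm_nonneg _)))
    (fun k B c φ => (hf2 k B c φ).trans (by
      have := hle k
      gcongr))
    (fun k i j => by
      refine (hf0 k (e k j) (fun i => if i = j then 1 else 0) ?_ i)
      convert hasSum_ite_eq j (e k j) using 2 with l
      split_ifs with h
      · rw [h, one_smul]
      · rw [zero_smul])
    hne hq hqt hK0 hK hup
  have hfa : ∀ k j, f k j (x k) = a k j := fun k j => hf0 k (x k) (a k) (ha k) j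
  set w : ℕ → ℝ := fun j => ∏ k, ‖a k j‖ ^ (n k : ℝ) with hw
  have hw0 : ∀ j, 0 ≤ w j := fun j => Finset.prod_nonneg fun _ _ => by positivity
  set L : ℝ := 1 + ∑ k, ‖x k‖ with hL
  have hL0 : 0 < L := by positivity
  have hxL : ∀ k, ‖x k‖ ≤ L := fun k => by
    have := Finset.single_le_sum (f := fun k => ‖x k‖) (fun _ _ => norm_nonneg _)
      (Finset.mem_univ k)
    linarith
  set D := Fintype.card (Σ k : Fin m, Fin (n k)) with hD
  have hprod : ∀ j, ∏ i : Σ k : Fin m, Fin (n k), ‖f i.1 j (((L⁻¹ : ℝ) : 𝕂) • x i.1)‖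
      = L⁻¹ ^ D * w j := by
    intro j
    simp only [map_smul, norm_smul, hfa, RCLike.norm_ofReal, abs_of_pos (inv_pos.2 hL0),
      Finset.prod_mul_distrib, Finset.prod_const, Finset.card_univ]
    rw [Fintype.prod_sigma]
    simp [hw, hD]
  have hq' : 0 < min t t₀ := hq.trans hqt
  have hbd : ∀ N, ∑ j ∈ Finset.range N, w j ^ min t t₀ ≤ ((L ^ D) ^ min t t₀) * S₀ := by
    intro N
    have h1 := hS₀ N (fun k => ((L⁻¹ : ℝ) : 𝕂) • x k) fun k => by
      rw [norm_smul, RCLike.norm_ofReal, abs_of_pos (inv_pos.2 hL0), inv_mul_le_iff₀ hL0, mul_one]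
      exact hxL k
    simp only [hprod] at h1
    have h2 : ∀ j, (L⁻¹ ^ D * w j) ^ min t t₀ = ((L ^ D) ^ min t t₀)⁻¹ * w j ^ min t t₀ := by
      intro j
      rw [Real.mul_rpow (by positivity) (hw0 j), inv_pow, Real.inv_rpow (by positivity)]
    simp only [h2] at h1
    rwa [← Finset.mul_sum, inv_mul_le_iff₀ (by positivity)] at h1
  have hs : Summable fun j => w j ^ min t t₀ :=
    summable_of_sum_range_le (fun j => Real.rpow_nonneg (hw0 j) _) hbd
  refine hs.of_norm_bounded_eventually_nat ?_
  filter_upwards [hs.tendsto_atTop_zero.eventually (eventually_lt_nhds zero_lt_one)] with j hj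
  rw [Real.norm_of_nonneg (Real.rpow_nonneg (hw0 j) _)]
  have h1 : w j ≤ 1 := by
    by_contra hcon
    exact absurd hj (not_lt.2 (Real.one_lt_rpow (not_le.1 hcon) hq').le)
  rcases (hw0 j).eq_or_lt with h0 | h0
  · change w j ^ t ≤ w j ^ min t t₀
    rw [← h0, Real.zero_rpow hq'.ne', Real.zero_rpow (hq.trans ht).ne']
  · exact Real.rpow_le_rpow_of_exponent_ge h0 h1 (min_le_left _ _)
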